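/- arXiv:2011.03220 — 3 statements merged into one kernel-verified Lean document; each statement's English description precedes it below -/
import Mathlib

section
/- For every n ≥ 1 and every 1 < p < ∞ there exists a constant C = C(n,p) ≥ 1 such that for every smooth compactly supported function φ : ℝⁿ → ℝ one has C⁻¹ (‖φ‖_{L^p} + ‖Δφ‖_{L^p}) ≤ ‖φ‖_{L^p} + ‖∇φ‖_{L^p} + ‖Hess φ‖_{L^p} ≤ C (‖φ‖_{L^p} + ‖Δφ‖_{L^p}); that is, the Sobolev norms ‖u‖_{W^{2,p}} = ‖u‖_{L^p} + ‖∇u‖_{L^p} + ‖Hess u‖_{L^p} and ‖u‖_{W̃^{2,p}} = ‖u‖_{L^p} + ‖Δu‖_{L^p} are equivalent on C_c^∞(ℝⁿ). -/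
open MeasureTheory

/-- Partial derivative `∂ᵢ u` of a function on `ℝⁿ = EuclideanSpace ℝ (Fin n)`. -/
noncomputable def pd {n : ℕ} (u : EuclideanSpace ℝ (Fin n) → ℝ) (i : Fin n)
    (x : EuclideanSpace ℝ (Fin n)) : ℝ :=
  fderiv ℝ u x (EuclideanSpace.single i 1)

/-- Second partial derivative `∂ᵢ∂ⱼ u`. -/
noncomputable def pd2 {n : ℕ} (u : EuclideanSpace ℝ (Fin n) → ℝ) (i j : Fin n)
    (x : EuclideanSpace ℝ (Fin n)) : ℝ :=
  pd (pd u j) i x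

/-- Laplacian `Δu = ∑ᵢ ∂ᵢ² u`. -/
noncomputable def lap {n : ℕ} (u : EuclideanSpace ℝ (Fin n) → ℝ)
    (x : EuclideanSpace ℝ (Fin n)) : ℝ :=
  ∑ i : Fin n, pd2 u i i x

/-- Euclidean norm of the gradient, `|∇u|(x) = (∑ᵢ (∂ᵢu)²)^{1/2}`. -/
noncomputable def gradNorm {n : ℕ} (u : EuclideanSpace ℝ (Fin n) → ℝ)
    (x : EuclideanSpace ℝ (Fin n)) : ℝ :=
  Real.sqrt (∑ i : Fin n, pd u i x ^ 2)

/-- Hilbert–Schmidt norm of the Hessian, `|Hess u|(x) = (∑_{i,j} (∂ᵢ∂ⱼu)²)^{1/2}`. -/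
noncomputable def hessNorm {n : ℕ} (u : EuclideanSpace ℝ (Fin n) → ℝ)
    (x : EuclideanSpace ℝ (Fin n)) : ℝ :=
  Real.sqrt (∑ i : Fin n, ∑ j : Fin n, pd2 u i j x ^ 2)

/-- `L^p` norm with respect to Lebesgue measure on `ℝⁿ`:  `(∫ |f|^p)^{1/p}`. -/
noncomputable def lpNorm {n : ℕ} (p : ℝ) (f : EuclideanSpace ℝ (Fin n) → ℝ) : ℝ :=
  (∫ x, |f x| ^ p) ^ (1 / p)


namespace CZ

lemma tangent {r x a : ℝ} (hr : 1 < r) (hx : 0 ≤ x) (ha : 0 ≤ a) :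
    a ^ r + r * a ^ (r - 1) * (x - a) ≤ x ^ r := by
  rcases ha.eq_or_lt with rfl | ha
  · rw [Real.zero_rpow (by linarith), Real.zero_rpow (by linarith)]
    have := Real.rpow_nonneg hx r
    linarith
  · have h := one_add_mul_self_le_rpow_one_add (s := x / a - 1) (by
      have : 0 ≤ x / a := by positivity
      linarith) hr.le
    rw [show 1 + (x / a - 1) = x / a by ring, Real.div_rpow hx ha.le] at h
    have har : 0 < a ^ r := Real.rpow_pos_of_pos ha r
    rw [le_div_iff₀ har] at h
    rw [Real.rpow_sub_one ha.ne']
    refine le_trans (le_of_eq ?_) h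
    field_simp

lemma clarkson {p m d : ℝ} (hp : 2 ≤ p) (hd : |d| ≤ m) :
    2 * (m ^ p + |d| ^ p) ≤ (m + d) ^ p + (m - d) ^ p := by
  have hm : 0 ≤ m := (abs_nonneg d).trans hd
  obtain ⟨h1, h2⟩ := abs_le.1 hd
  have e : ∀ t : ℝ, 0 ≤ t → t ^ p = (t ^ 2) ^ (p / 2) := by
    intro t ht
    rw [← Real.rpow_natCast_mul ht]
    congr 1; push_cast; ring
  have hc := (convexOn_rpow (p := p / 2) (by linarith)).2 (Set.mem_Ici.2 (sq_nonneg (m + d)))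
    (Set.mem_Ici.2 (sq_nonneg (m - d))) (show (0:ℝ) ≤ 1 / 2 by norm_num)
    (show (0:ℝ) ≤ 1 / 2 by norm_num) (by norm_num)
  have ha := Real.add_rpow_le_rpow_add (a := m ^ 2) (b := |d| ^ 2) (p := p / 2) (by positivity) (by positivity)
    (by linarith)
  rw [e m hm, e |d| (abs_nonneg d), e (m + d) (by linarith), e (m - d) (by linarith)]
  simp only [smul_eq_mul] at hc
  rw [show 1 / 2 * (m + d) ^ 2 + 1 / 2 * (m - d) ^ 2 = m ^ 2 + |d| ^ 2 by rw [sq_abs]; ring] at hc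
  linarith

lemma breg_p {p x a : ℝ} (hp : 2 ≤ p) (hx : 0 ≤ x) (ha : 0 ≤ a) :
    a ^ p + p * a ^ (p - 1) * (x - a) + 2 * (1 / 2 : ℝ) ^ p * |x - a| ^ p ≤ x ^ p := by
  have h1 := tangent (r := p) (x := (x + a) / 2) (by linarith) (by positivity) ha
  have h2 := clarkson (p := p) (m := (x + a) / 2) (d := (x - a) / 2) hp
    (by rw [abs_le]; constructor <;> linarith)
  rw [show (x + a) / 2 + (x - a) / 2 = x by ring, show (x + a) / 2 - (x - a) / 2 = a by ring,
    show |(x - a) / 2| = (1 / 2) * |x - a| by rw [abs_div]; norm_num; ring,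
    Real.mul_rpow (by norm_num) (abs_nonneg _)] at h2
  nlinarith

lemma breg_q {q y b : ℝ} (hq : 1 < q) (hb : 0 ≤ b) (hy : 2 * b ≤ y) :
    b ^ q + q * b ^ (q - 1) * (y - b) + (1 - (1 / 2 : ℝ) ^ q * (1 + q)) * (y - b) ^ q ≤ y ^ q := by
  have hy0 : 0 ≤ y := by linarith
  have hc : 0 ≤ 1 - (1 / 2 : ℝ) ^ q * (1 + q) := by
    have := one_add_mul_self_le_rpow_one_add (s := 1) (by norm_num) hq.le
    have h2 : (1 / 2 : ℝ) ^ q * (1 + 1) ^ q = 1 := by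
      rw [← Real.mul_rpow] <;> norm_num
    have h3 : (0 : ℝ) < (1 / 2 : ℝ) ^ q := by positivity
    have := mul_le_mul_of_nonneg_left this h3.le
    linarith
  have h1 := tangent (r := q) (x := y / 2) hq (by positivity) hb
  have h3 : q * b ^ (q - 1) * (y / 2) ≤ q * (y / 2) ^ (q - 1) * (y / 2) := by
    have : b ^ (q - 1) ≤ (y / 2) ^ (q - 1) := Real.rpow_le_rpow hb (by linarith) (by linarith)
    gcongr
  have h4 : (y / 2) ^ (q - 1) * (y / 2) = (y / 2) ^ q := by
    rcases hy0.eq_or_lt with h | h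
    · rw [← h]; simp [Real.zero_rpow (show q ≠ 0 by linarith)]
    · rw [Real.rpow_sub_one (by positivity)]; field_simp
  have h5 : (y - b) ^ q ≤ y ^ q := Real.rpow_le_rpow (by linarith) (by linarith) (by linarith)
  have h6 : (y / 2) ^ q = (1 / 2) ^ q * y ^ q := by
    rw [← Real.mul_rpow (by norm_num) hy0]; congr 1; ring
  have h7 := mul_le_mul_of_nonneg_left h5 hc
  nlinarith

lemma cq_pos {q : ℝ} (hq : 1 < q) : 0 < 1 - (1 / 2 : ℝ) ^ q * (1 + q) := by
  have := one_add_mul_self_lt_rpow_one_add (s := 1) (by norm_num) (by norm_num) hq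
  have h2 : (1 / 2 : ℝ) ^ q * (1 + 1) ^ q = 1 := by
    rw [← Real.mul_rpow] <;> norm_num
  have h3 : (0 : ℝ) < (1 / 2 : ℝ) ^ q := by positivity
  have := mul_lt_mul_of_pos_left this h3
  linarith

lemma breg_sqrt {s b y : ℝ} (hs : 0 < s) :
    √(s ^ 2 + b ^ 2) + b / √(s ^ 2 + b ^ 2) * (y - b)
      + s ^ 2 * (y - b) ^ 2 / (2 * (s ^ 2 + b ^ 2) * √(s ^ 2 + y ^ 2)) ≤ √(s ^ 2 + y ^ 2) := by
  have hS : 0 < √(s ^ 2 + b ^ 2) := Real.sqrt_pos.2 (by positivity)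
  have hY : 0 < √(s ^ 2 + y ^ 2) := Real.sqrt_pos.2 (by positivity)
  have hS2 := Real.sq_sqrt (show 0 ≤ s ^ 2 + b ^ 2 by positivity)
  have hY2 := Real.sq_sqrt (show 0 ≤ s ^ 2 + y ^ 2 by positivity)
  set S := √(s ^ 2 + b ^ 2)
  set Y := √(s ^ 2 + y ^ 2)
  have key : (Y * S) ^ 2 - (s ^ 2 + b * y) ^ 2 = s ^ 2 * (y - b) ^ 2 := by
    rw [mul_pow, hY2, hS2]; ring
  have h1 : s ^ 2 + b * y ≤ Y * S := by
    refine le_of_abs_le (abs_le_of_sq_le_sq ?_ (by positivity))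
    nlinarith [sq_nonneg (s * (y - b))]
  have e : S + b / S * (y - b) + s ^ 2 * (y - b) ^ 2 / (2 * (s ^ 2 + b ^ 2) * Y)
      = (2 * Y * S * (S ^ 2 + b * (y - b)) + s ^ 2 * (y - b) ^ 2) / (2 * S ^ 2 * Y) := by
    rw [← hS2]; field_simp
  rw [e, div_le_iff₀ (by positivity), ← key, hS2]
  have : 2 * Y * S * (s ^ 2 + b ^ 2 + b * (y - b)) = 2 * (Y * S) * (s ^ 2 + b * y) := by ring
  rw [this]
  nlinarith [sq_nonneg (Y * S - (s ^ 2 + b * y))]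

/-- building block of the Bellman function -/
noncomputable def F (q s x y : ℝ) : ℝ :=
  s ^ (2 - q) * x ^ 2 + s ^ (q - 1) * √(s ^ 2 + y ^ 2) - 3 * s ^ q

lemma F_le {p q s x y : ℝ} (hpq : p.HolderConjugate q) (hp : 2 ≤ p) (hs : 0 < s) :
    F q s x y ≤ |x| ^ p + |y| ^ q := by
  have hq1 := hpq.symm.lt
  have hq2 : q ≤ 2 := by
    have := hpq.inv_add_inv_eq_one
    have h1 : p⁻¹ ≤ 2⁻¹ := by gcongr
    have h2 : (2 : ℝ)⁻¹ ≤ q⁻¹ := by norm_num at *; linarith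
    exact (inv_le_inv₀ (by norm_num) (by linarith)).1 h2
  have hmul : p * q = p + q := hpq.mul_eq_add
  have hx : s ^ (2 - q) * x ^ 2 ≤ s ^ q + |x| ^ p := by
    rw [← sq_abs]
    have hx0 := abs_nonneg x
    rcases le_total |x| (s ^ (q - 1)) with h | h
    · have : s ^ (2 - q) * |x| ^ 2 ≤ s ^ (2 - q) * (s ^ (q - 1)) ^ 2 := by gcongr
      have e : s ^ (2 - q) * (s ^ (q - 1)) ^ 2 = s ^ q := by
        rw [← Real.rpow_mul_natCast hs.le, ← Real.rpow_add hs]; congr 1; push_cast; ring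
      have := Real.rpow_nonneg hx0 p
      linarith
    · have hxp : 0 < |x| := lt_of_lt_of_le (by positivity) h
      have h1 : s ≤ |x| ^ (p - 1) := by
        have := Real.rpow_le_rpow (by positivity) h (show 0 ≤ p - 1 by linarith)
        rw [← Real.rpow_mul hs.le, show (q - 1) * (p - 1) = 1 by linarith, Real.rpow_one] at this
        exact this
      have h2 : s ^ (2 - q) ≤ |x| ^ (p - 2) := by
        have := Real.rpow_le_rpow hs.le h1 (show 0 ≤ 2 - q by linarith)
        rwa [← Real.rpow_mul hx0, show (p - 1) * (2 - q) = p - 2 by linarith] at this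
      have h3 : s ^ (2 - q) * |x| ^ 2 ≤ |x| ^ (p - 2) * |x| ^ 2 := by gcongr
      have e : |x| ^ (p - 2) * |x| ^ 2 = |x| ^ p := by
        rw [← Real.rpow_natCast, ← Real.rpow_add hxp]; congr 1; push_cast; ring
      have : 0 < s ^ q := by positivity
      linarith
  have hy : s ^ (q - 1) * √(s ^ 2 + y ^ 2) ≤ 2 * s ^ q + |y| ^ q := by
    have hy0 := abs_nonneg y
    have h1 : √(s ^ 2 + y ^ 2) ≤ s + |y| := by
      rw [Real.sqrt_le_left (by positivity), ← sq_abs y]; nlinarith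
    have h2 : s ^ (q - 1) * √(s ^ 2 + y ^ 2) ≤ s ^ (q - 1) * (s + |y|) := by gcongr
    have e : ∀ t : ℝ, 0 < t → t ^ (q - 1) * t = t ^ q := by
      intro t ht; rw [Real.rpow_sub_one ht.ne']; field_simp
    have h3 : s ^ (q - 1) * |y| ≤ s ^ q + |y| ^ q := by
      rcases le_total |y| s with h | h
      · have : s ^ (q - 1) * |y| ≤ s ^ (q - 1) * s := by gcongr
        rw [e s hs] at this
        have := Real.rpow_nonneg hy0 q
        linarith
      · have h4 := Real.rpow_le_rpow hs.le h (show 0 ≤ q - 1 by linarith)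
        have : s ^ (q - 1) * |y| ≤ |y| ^ (q - 1) * |y| := by gcongr
        rw [e |y| (by linarith)] at this
        have : 0 < s ^ q := by positivity
        linarith
    have := e s hs
    nlinarith
  unfold F
  linarith

lemma F_mono {q s x b : ℝ} (hq1 : 1 < q) (hq2 : q ≤ 2) (hs : 0 < s) (hsb : s ≤ (q - 1) / 6 * b) :
    F q s x b ≤ F q ((q - 1) / 6 * b) x b := by
  set k := (q - 1) / 6 with hk
  have hk0 : 0 < k := by rw [hk]; linarith
  have hb : 0 < b := by
    by_contra h
    have : k * b ≤ 0 := by nlinarith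
    linarith
  set τ := k * b with hτ
  have hτ0 : 0 < τ := by positivity
  have h1 : s ^ (2 - q) * x ^ 2 ≤ τ ^ (2 - q) * x ^ 2 := by
    have := Real.rpow_le_rpow hs.le hsb (show 0 ≤ 2 - q by linarith)
    gcongr
  have e : ∀ t : ℝ, 0 < t → t ^ (q - 1) * t = t ^ q := by
    intro t ht; rw [Real.rpow_sub_one ht.ne']; field_simp
  have h2 : s ^ (q - 1) * (√(s ^ 2 + b ^ 2) - 3 * s) ≤ τ ^ (q - 1) * (√(τ ^ 2 + b ^ 2) - 3 * τ) := by
    have hR : √(s ^ 2 + b ^ 2) ≤ √(τ ^ 2 + b ^ 2) := by gcongr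
    have hRb : b ≤ √(τ ^ 2 + b ^ 2) := by
      apply Real.le_sqrt_of_sq_le; nlinarith
    set R := √(τ ^ 2 + b ^ 2)
    set r := s / τ with hr
    have hr0 : 0 < r := by positivity
    have hr1 : r ≤ 1 := by rw [hr, div_le_one hτ0]; exact hsb
    have es : s = r * τ := by rw [hr]; field_simp
    have hber := rpow_one_add_le_one_add_mul_self (s := r - 1) (by linarith)
      (p := q - 1) (by linarith) (by linarith)
    rw [show 1 + (r - 1) = r by ring] at hber
    have hsq : s ^ (q - 1) = r ^ (q - 1) * τ ^ (q - 1) := by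
      rw [es, Real.mul_rpow hr0.le hτ0.le]
    have hpos : 0 ≤ R - 3 * s := by
      have : 3 * τ ≤ b := by rw [hτ, hk]; nlinarith
      linarith
    have hfin : r ^ (q - 1) * (R - 3 * s) ≤ R - 3 * τ := by
      have h3 : r ^ (q - 1) * (R - 3 * s) ≤ (1 + (q - 1) * (r - 1)) * (R - 3 * s) := by gcongr
      have h4 : 3 * τ ≤ (q - 1) * (R - 3 * s) := by
        have : 3 * s ≤ b / 2 := by
          have : 3 * τ ≤ b / 2 := by rw [hτ, hk]; nlinarith
          linarith
        have h5 : 3 * τ = (q - 1) * (b / 2) := by rw [hτ, hk]; ring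
        rw [h5]
        have : b / 2 ≤ R - 3 * s := by linarith
        have hq0 : 0 ≤ q - 1 := by linarith
        gcongr
      have h6 : 3 * τ * (1 - r) ≤ (q - 1) * (R - 3 * s) * (1 - r) := by
        have : 0 ≤ 1 - r := by linarith
        gcongr
      rw [es] at h3 h6 ⊢
      nlinarith
    calc s ^ (q - 1) * (√(s ^ 2 + b ^ 2) - 3 * s) ≤ s ^ (q - 1) * (R - 3 * s) := by gcongr
      _ = τ ^ (q - 1) * (r ^ (q - 1) * (R - 3 * s)) := by rw [hsq]; ring
      _ ≤ τ ^ (q - 1) * (R - 3 * τ) := by gcongr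
  have := e s hs
  have := e τ hτ0
  unfold F
  nlinarith

set_option maxHeartbeats 1000000 in
lemma F_breg {p q : ℝ} (hpq : p.HolderConjugate q) (hp : 2 ≤ p) : ∃ c > 0, ∀ a b s : ℝ,
    0 ≤ a → 0 ≤ b → 0 < s → (q - 1) / 6 * b ≤ s → ∃ α β : ℝ, ∀ x y : ℝ, 0 ≤ x → 0 ≤ y →
    F q s a b + (a ^ p + b ^ q) + α * (x - a) + β * (y - b) + c * (|x - a| * |y - b|) ≤
    F q s x y + (x ^ p + y ^ q) := by
  have hq1 := hpq.symm.lt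
  set k := (q - 1) / 6 with hk
  have hk0 : 0 < k := by rw [hk]; linarith
  set L : ℝ := 1 + 4 / k ^ 2 with hL
  have hL1 : 1 ≤ L := by rw [hL]; have : 0 ≤ 4 / k ^ 2 := by positivity
                         linarith
  set cp : ℝ := 2 * (1 / 2 : ℝ) ^ p with hcp
  set cq : ℝ := 1 - (1 / 2 : ℝ) ^ q * (1 + q) with hcq
  have hcp0 : 0 < cp := by positivity
  have hcq0 : 0 < cq := cq_pos hq1
  set c := min (1 / L) (min cp cq) with hc
  have hc0 : 0 < c := by rw [hc]; positivity
  have hc1 : c ≤ 1 / L := min_le_left _ _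
  have hc2 : c ≤ cp := (min_le_right _ _).trans (min_le_left _ _)
  have hc3 : c ≤ cq := (min_le_right _ _).trans (min_le_right _ _)
  refine ⟨c, hc0, ?_⟩
  intro a b s ha hb hs hsb
  refine ⟨s ^ (2 - q) * (2 * a) + p * a ^ (p - 1),
    s ^ (q - 1) * (b / √(s ^ 2 + b ^ 2)) + q * b ^ (q - 1), ?_⟩
  intro x y hx hy
  have hsq := breg_sqrt (b := b) (y := y) hs
  have hsp : 0 < s ^ (q - 1) := by positivity
  have hdp : 0 < s ^ (2 - q) := by positivity
  have hP := breg_p hp hx ha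
  rw [← hcp] at hP
  unfold F
  set D := s ^ (2 - q) with hD
  have hsD : s ^ (q - 1) = s / D := by
    rw [hD, eq_div_iff hdp.ne', hD, ← Real.rpow_add hs]
    rw [show q - 1 + (2 - q) = 1 by ring, Real.rpow_one]
  have hxe : D * x ^ 2 = D * a ^ 2 + D * (2 * a) * (x - a) + D * (x - a) ^ 2 := by ring
  have hrem : 0 ≤ s ^ 2 * (y - b) ^ 2 / (2 * (s ^ 2 + b ^ 2) * √(s ^ 2 + y ^ 2)) := by positivity
  rcases le_total y (2 * b) with h | h
  · have hQ := tangent hq1 hy hb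
    have hbs : b ≤ s / k := by rw [le_div_iff₀ hk0]; linarith
    have hb2 : b ^ 2 ≤ s ^ 2 / k ^ 2 := by rw [← div_pow]; gcongr
    have hS : s ^ 2 + b ^ 2 ≤ L * s ^ 2 := by
      rw [hL]
      have : 0 ≤ s ^ 2 / k ^ 2 := by positivity
      have : (1 + 4 / k ^ 2) * s ^ 2 = s ^ 2 + 4 * (s ^ 2 / k ^ 2) := by ring
      linarith
    have hY : √(s ^ 2 + y ^ 2) ≤ L * s := by
      rw [Real.sqrt_le_left (by positivity)]
      have h1 : y ^ 2 ≤ 4 * b ^ 2 := by nlinarith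
      have h2 : (1 + 4 / k ^ 2) * s ^ 2 = s ^ 2 + 4 * (s ^ 2 / k ^ 2) := by ring
      rw [← hL] at h2
      have h3 : L * s ^ 2 ≤ (L * s) ^ 2 := by
        rw [mul_pow]; gcongr; nlinarith
      linarith
    have hY0 : 0 < √(s ^ 2 + y ^ 2) := Real.sqrt_pos.2 (by positivity)
    have hr : (y - b) ^ 2 / (2 * L ^ 2 * s) ≤
        s ^ 2 * (y - b) ^ 2 / (2 * (s ^ 2 + b ^ 2) * √(s ^ 2 + y ^ 2)) := by
      calc (y - b) ^ 2 / (2 * L ^ 2 * s) = s ^ 2 * (y - b) ^ 2 / (2 * (L * s ^ 2) * (L * s)) := by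
            field_simp
        _ ≤ _ := by gcongr
    have hfin : c * (|x - a| * |y - b|) ≤ D * (x - a) ^ 2 + s ^ (q - 1) * ((y - b) ^ 2 / (2 * L ^ 2 * s)) := by
      have e1 : s ^ (q - 1) * ((y - b) ^ 2 / (2 * L ^ 2 * s)) = (|y - b|) ^ 2 / (2 * L ^ 2 * D) := by
        rw [hsD, sq_abs]; field_simp
      rw [e1, ← sq_abs (x - a)]
      have h1 : c * (|x - a| * |y - b|) ≤ 1 / L * (|x - a| * |y - b|) := by gcongr
      refine h1.trans ?_
      have h2 : D * |x - a| ^ 2 + |y - b| ^ 2 / (2 * L ^ 2 * D) - 1 / L * (|x - a| * |y - b|)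
        = ((|y - b| - L * D * |x - a|) ^ 2 + (L * D * |x - a|) ^ 2) / (2 * L ^ 2 * D) := by
        field_simp; ring
      have h3 : 0 ≤ ((|y - b| - L * D * |x - a|) ^ 2 + (L * D * |x - a|) ^ 2) / (2 * L ^ 2 * D) := by
        positivity
      linarith
    have h5 : 0 ≤ cp * |x - a| ^ p := by positivity
    have h6 := mul_le_mul_of_nonneg_left hsq hsp.le
    have h7 := mul_le_mul_of_nonneg_left hr hsp.le
    clear_value D cp cq c
    rw [mul_add, mul_add] at h6
    linarith only [h5, h6, h7, hfin, hxe, hP, hQ]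
  · have hQ := breg_q hq1 hb h
    rw [← hcq] at hQ
    have hyo := Real.young_inequality_of_nonneg (abs_nonneg (x - a)) (show 0 ≤ y - b by linarith) hpq
    have h1 : |x - a| ^ p / p ≤ |x - a| ^ p := div_le_self (by positivity) (by linarith)
    have h2 : (y - b) ^ q / q ≤ (y - b) ^ q :=
      div_le_self (Real.rpow_nonneg (by linarith) _) (by linarith)
    have h0 : 0 ≤ (y - b) ^ q := Real.rpow_nonneg (by linarith) _
    have h0' : 0 ≤ |x - a| ^ p := by positivity
    have hfin : c * (|x - a| * |y - b|) ≤ cp * |x - a| ^ p + cq * (y - b) ^ q := by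
      rw [abs_of_nonneg (show 0 ≤ y - b by linarith)]
      calc c * (|x - a| * (y - b)) ≤ c * (|x - a| ^ p + (y - b) ^ q) := by gcongr; linarith
        _ = c * |x - a| ^ p + c * (y - b) ^ q := by ring
        _ ≤ _ := by gcongr
    have h6 := mul_le_mul_of_nonneg_left hsq hsp.le
    have h7 := mul_nonneg hsp.le hrem
    have h8 : 0 ≤ D * (x - a) ^ 2 := by positivity
    clear_value D cp cq c
    rw [mul_add, mul_add] at h6
    linarith only [h6, h7, h8, hfin, hxe, hP, hQ]

end CZ

namespace CZ

def IsBellman (p q C : ℝ) (Q : ℝ → ℝ → ℝ) : Prop :=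
  (∀ x y, 0 ≤ Q x y) ∧ (∀ x y, 0 ≤ x → 0 ≤ y → Q x y ≤ C * (x ^ p + y ^ q)) ∧
  Measurable (fun z : ℝ × ℝ => Q z.1 z.2) ∧
  ∀ a b : ℝ, 0 ≤ a → 0 ≤ b → ∀ ε > 0, ∃ α β : ℝ, ∀ x y : ℝ, 0 ≤ x → 0 ≤ y →
    Q a b + α * (x - a) + β * (y - b) + |x - a| * |y - b| ≤ Q x y + ε

lemma bellman_aux {p q : ℝ} (hpq : p.HolderConjugate q) (hp : 2 ≤ p) :
    ∃ Q C, 0 < C ∧ IsBellman p q C Q := by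
  have hq1 := hpq.symm.lt
  have hq2 : q ≤ 2 := by
    have := hpq.inv_add_inv_eq_one
    have h1 : p⁻¹ ≤ 2⁻¹ := by gcongr
    have h2 : (2 : ℝ)⁻¹ ≤ q⁻¹ := by norm_num at *; linarith
    exact (inv_le_inv₀ (by norm_num) (by linarith)).1 h2
  obtain ⟨c, hc, H⟩ := F_breg hpq hp
  let ι := {s : ℝ // 0 < s}
  haveI : Nonempty ι := ⟨⟨1, one_pos⟩⟩
  let G : ℝ → ℝ → ℝ := fun x y => ⨆ s : ι, F q s.1 x y
  have hbdd : ∀ x y, BddAbove (Set.range fun s : ι => F q s.1 x y) := by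
    intro x y
    refine ⟨|x| ^ p + |y| ^ q, ?_⟩
    rintro _ ⟨s, rfl⟩
    exact F_le hpq hp s.2
  have hG0 : ∀ x y, 0 ≤ G x y := by
    intro x y
    refine le_of_forall_pos_le_add fun ε hε => ?_
    let s : ι := ⟨(ε / 3) ^ (1 / q), by positivity⟩
    have h1 : F q s.1 x y ≤ G x y := le_ciSup (hbdd x y) s
    have hs := s.2
    have h2 : -ε ≤ F q s.1 x y := by
      unfold F
      have e : s.1 ^ q = ε / 3 := by
        change ((ε / 3) ^ (1 / q)) ^ q = ε / 3
        rw [← Real.rpow_mul (by positivity), one_div, inv_mul_cancel₀ (by linarith), Real.rpow_one]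
      rw [e]
      have : 0 ≤ s.1 ^ (2 - q) * x ^ 2 := by positivity
      have : 0 ≤ s.1 ^ (q - 1) * √(s.1 ^ 2 + y ^ 2) := by positivity
      linarith
    linarith
  have hGle : ∀ x y, G x y ≤ |x| ^ p + |y| ^ q := fun x y => ciSup_le fun s => F_le hpq hp s.2
  refine ⟨fun x y => c⁻¹ * (G x y + (|x| ^ p + |y| ^ q)), c⁻¹ * 2, by positivity, ?_, ?_, ?_, ?_⟩
  · intro x y
    have := hG0 x y
    positivity
  · intro x y hx hy
    have := hGle x y
    simp only [abs_of_nonneg hx, abs_of_nonneg hy] at *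
    rw [mul_assoc]
    gcongr
    linarith
  · refine Measurable.const_mul (Measurable.add ?_ (by fun_prop)) _
    refine LowerSemicontinuous.measurable ?_
    refine lowerSemicontinuous_ciSup (fun z => hbdd z.1 z.2) (fun s => Continuous.lowerSemicontinuous ?_)
    unfold F
    fun_prop
  · intro a b ha hb ε hε
    obtain ⟨s0, hs0⟩ := exists_lt_of_lt_ciSup (show G a b - c * ε < ⨆ s : ι, F q s.1 a b by
      have : 0 < c * ε := by positivity
      change G a b - c * ε < G a b
      linarith)
    have : ∃ s : ι, (q - 1) / 6 * b ≤ s.1 ∧ G a b - c * ε < F q s.1 a b := by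
      rcases le_total s0.1 ((q - 1) / 6 * b) with h | h
      · exact ⟨⟨(q - 1) / 6 * b, lt_of_lt_of_le s0.2 h⟩, le_rfl,
          lt_of_lt_of_le hs0 (F_mono hq1 hq2 s0.2 h)⟩
      · exact ⟨s0, h, hs0⟩
    obtain ⟨s, hs1, hs2⟩ := this
    obtain ⟨α, β, hab⟩ := H a b s.1 ha hb s.2 hs1
    refine ⟨c⁻¹ * α, c⁻¹ * β, fun x y hx hy => ?_⟩
    have h1 := hab x y hx hy
    have h2 : F q s.1 x y ≤ G x y := le_ciSup (hbdd x y) s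
    simp only [abs_of_nonneg hx, abs_of_nonneg hy, abs_of_nonneg ha, abs_of_nonneg hb]
    have h3 : G a b + (a ^ p + b ^ q) + α * (x - a) + β * (y - b) + c * (|x - a| * |y - b|)
      ≤ G x y + (x ^ p + y ^ q) + c * ε := by linarith
    have h4 := mul_le_mul_of_nonneg_left h3 (inv_pos.2 hc).le
    have e1 : c⁻¹ * (c * (|x - a| * |y - b|)) = |x - a| * |y - b| := by field_simp
    have e2 : c⁻¹ * (c * ε) = ε := by field_simp
    simp only [mul_add, ] at h4 ⊢
    rw [e1, e2] at h4
    linarith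

lemma bellman {p q : ℝ} (hpq : p.HolderConjugate q) : ∃ Q C, 0 < C ∧ IsBellman p q C Q := by
  rcases le_total 2 p with h | h
  · exact bellman_aux hpq h
  · have hq : 2 ≤ q := by
      have := hpq.inv_add_inv_eq_one
      have h1 : (2 : ℝ)⁻¹ ≤ p⁻¹ := by
        have := hpq.pos
        gcongr
      have h2 : q⁻¹ ≤ 2⁻¹ := by norm_num at *; linarith
      exact (inv_le_inv₀ hpq.symm.pos (by norm_num)).1 h2
    obtain ⟨Q, C, hC, h1, h2, h3, h4⟩ := bellman_aux hpq.symm hq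
    refine ⟨fun x y => Q y x, C, hC, fun x y => h1 y x, fun x y hx hy => ?_, ?_, ?_⟩
    · rw [add_comm]; exact h2 y x hy hx
    · exact h3.comp measurable_swap
    · intro a b ha hb ε hε
      obtain ⟨α, β, h⟩ := h4 b a hb ha ε hε
      refine ⟨β, α, fun x y hx hy => ?_⟩
      have := h y x hy hx
      rw [mul_comm |x - a|]
      linarith

/-- Jensen gap -/
lemma IsBellman.jensen {p q C : ℝ} {Q : ℝ → ℝ → ℝ} (hQ : IsBellman p q C Q) {ι : Type*} [Fintype ι]
    [Nonempty ι] (X Y : ι → ℝ) (hX : ∀ i, 0 ≤ X i) (hY : ∀ i, 0 ≤ Y i) (a b : ℝ)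
    (ha : a = (Fintype.card ι : ℝ)⁻¹ * ∑ i, X i) (hb : b = (Fintype.card ι : ℝ)⁻¹ * ∑ i, Y i) :
    Fintype.card ι * Q a b + ∑ i, |X i - a| * |Y i - b| ≤ ∑ i, Q (X i) (Y i) := by
  have hN : (0 : ℝ) < Fintype.card ι := by exact_mod_cast Fintype.card_pos
  have ha0 : 0 ≤ a := by
    rw [ha]; exact mul_nonneg (by positivity) (Finset.sum_nonneg fun i _ => hX i)
  have hb0 : 0 ≤ b := by
    rw [hb]; exact mul_nonneg (by positivity) (Finset.sum_nonneg fun i _ => hY i)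
  refine le_of_forall_pos_le_add fun ε hε => ?_
  obtain ⟨α, β, h⟩ := hQ.2.2.2 a b ha0 hb0 (ε / Fintype.card ι) (by positivity)
  have hs := Finset.sum_le_sum (s := Finset.univ) fun i _ => h (X i) (Y i) (hX i) (hY i)
  simp only [Finset.sum_add_distrib, ← Finset.mul_sum, Finset.sum_sub_distrib, Finset.sum_const,
    Finset.card_univ, nsmul_eq_mul] at hs
  have e1 : ∑ i, X i = Fintype.card ι * a := by rw [ha]; field_simp
  have e2 : ∑ i, Y i = Fintype.card ι * b := by rw [hb]; field_simp
  rw [e1, e2, mul_div_cancel₀ _ hN.ne'] at hs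
  simpa using hs

end CZ

namespace CZ

abbrev E (n : ℕ) := EuclideanSpace ℝ (Fin n)

def CC {n : ℕ} (u : E n → ℝ) : Prop := Continuous u ∧ HasCompactSupport u

variable {n : ℕ} {ι : Type*} [Fintype ι]

lemma CC.integrable {u : E n → ℝ} (h : CC u) : Integrable u :=
  h.1.integrable_of_hasCompactSupport h.2

lemma CC.shift {u : E n → ℝ} (h : CC u) (z : E n) : CC (fun x => u (x + z)) :=
  ⟨h.1.comp (by fun_prop), h.2.comp_homeomorph (Homeomorph.addRight z)⟩

lemma CC.mul {u v : E n → ℝ} (h : CC u) (h' : CC v) : CC (fun x => u x * v x) :=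
  ⟨h.1.mul h'.1, h.2.mul_right⟩

lemma CC.add {u v : E n → ℝ} (h : CC u) (h' : CC v) : CC (fun x => u x + v x) :=
  ⟨h.1.add h'.1, h.2.add h'.2⟩

lemma CC.const_mul {u : E n → ℝ} (h : CC u) (c : ℝ) : CC (fun x => c * u x) :=
  ⟨h.1.const_mul c, h.2.mul_left⟩

lemma CC.comp {u : E n → ℝ} (h : CC u) {g : ℝ → ℝ} (hg : Continuous g) (h0 : g 0 = 0) :
    CC (fun x => g (u x)) :=
  ⟨hg.comp h.1, h.2.comp_left h0⟩

lemma CC.zero : CC (fun _ : E n => (0 : ℝ)) :=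
  ⟨continuous_const, HasCompactSupport.zero⟩

lemma CC.sum {α : Type*} (s : Finset α) {u : α → E n → ℝ} (h : ∀ i, CC (u i)) :
    CC (fun x => ∑ i ∈ s, u i x) := by
  classical
  induction s using Finset.induction_on with
  | empty => simpa using CC.zero
  | insert a s ha ih => simp only [Finset.sum_insert ha]; exact (h a).add ih

lemma CC.rpow {u : E n → ℝ} (h : CC u) {p : ℝ} (hp : 0 < p) : CC (fun x => u x ^ p) :=
  h.comp (g := fun t => t ^ p) (Real.continuous_rpow_const hp.le) (Real.zero_rpow hp.ne')

/-- finite combination of translations -/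
def T (c : ι → ℝ) (z : ι → E n) : Module.End ℝ (E n → ℝ) where
  toFun u := fun x => ∑ i, c i * u (x + z i)
  map_add' u v := by ext x; simp [mul_add, Finset.sum_add_distrib]
  map_smul' a u := by
    ext x; simp only [Pi.smul_apply, smul_eq_mul, RingHom.id_apply, Finset.mul_sum]
    exact Finset.sum_congr rfl fun i _ => by ring

lemma T_apply (c : ι → ℝ) (z : ι → E n) (u : E n → ℝ) (x : E n) :
    T c z u x = ∑ i, c i * u (x + z i) := rfl

lemma T_comm (c c' : ι → ℝ) (z : ι → E n) : Commute (T c z) (T c' z) := by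
  ext u x
  simp only [Module.End.mul_apply, T_apply, Finset.mul_sum]
  rw [Finset.sum_comm]
  refine Finset.sum_congr rfl fun i _ => Finset.sum_congr rfl fun j _ => ?_
  rw [add_right_comm]; ring

lemma T_cc (c : ι → ℝ) (z : ι → E n) {u : E n → ℝ} (h : CC u) : CC (T c z u) :=
  CC.sum Finset.univ (fun i => (h.shift (z i)).const_mul (c i))

lemma Tpow_cc (c : ι → ℝ) (z : ι → E n) (k : ℕ) {u : E n → ℝ} (h : CC u) : CC ((T c z ^ k) u) := by
  induction k with
  | zero => simpa using h
  | succ k ih => rw [pow_succ', Module.End.mul_apply]; exact T_cc c z ih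

lemma T_symm {c : ι → ℝ} {z : ι → E n} (σ : ι ≃ ι) (hz : ∀ i, z (σ i) = - z i)
    (hc : ∀ i, c (σ i) = c i) {u v : E n → ℝ} (hu : CC u) (hv : CC v) :
    ∫ x, T c z u x * v x = ∫ x, u x * T c z v x := by
  simp only [T_apply, Finset.sum_mul, Finset.mul_sum]
  rw [integral_finsetSum _ (fun i _ => (((hu.shift (z i)).const_mul (c i)).mul hv).integrable),
    integral_finsetSum _ (fun i _ => (hu.mul ((hv.shift (z i)).const_mul (c i))).integrable)]
  rw [← Equiv.sum_comp σ]
  refine Finset.sum_congr rfl fun i _ => ?_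
  rw [← integral_add_right_eq_self _ (z i)]
  refine integral_congr_ae (Filter.Eventually.of_forall fun x => ?_)
  simp only [hz, hc, add_neg_cancel_right]
  ring

lemma Tpow_symm {c : ι → ℝ} {z : ι → E n} (σ : ι ≃ ι) (hz : ∀ i, z (σ i) = - z i)
    (hc : ∀ i, c (σ i) = c i) (k : ℕ) : ∀ {u v : E n → ℝ}, CC u → CC v →
    ∫ x, (T c z ^ k) u x * v x = ∫ x, u x * (T c z ^ k) v x := by
  induction k with
  | zero => intro u v _ _; simp
  | succ k ih =>
    intro u v hu hv
    rw [pow_succ, Module.End.mul_apply, ih (T_cc c z hu) hv, T_symm σ hz hc hu (Tpow_cc c z k hv),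
      ← Module.End.mul_apply, ← pow_succ', pow_succ]

lemma T_nonneg {c : ι → ℝ} {z : ι → E n} (hc : ∀ i, 0 ≤ c i) {u : E n → ℝ} (hu : ∀ x, 0 ≤ u x) (x : E n) :
    0 ≤ T c z u x := Finset.sum_nonneg fun i _ => mul_nonneg (hc i) (hu _)

lemma Tpow_nonneg {c : ι → ℝ} {z : ι → E n} (hc : ∀ i, 0 ≤ c i) {u : E n → ℝ} (hu : ∀ x, 0 ≤ u x)
    (k : ℕ) : ∀ x, 0 ≤ (T c z ^ k) u x := by
  induction k with
  | zero => simpa using hu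
  | succ k ih => rw [pow_succ', Module.End.mul_apply]; exact T_nonneg hc ih

lemma T_bound {c : ι → ℝ} {z : ι → E n} {u : E n → ℝ} {M : ℝ} (hu : ∀ x, |u x| ≤ M) (x : E n) :
    |T c z u x| ≤ (∑ i, |c i|) * M := by
  rw [T_apply, Finset.sum_mul]
  refine (Finset.abs_sum_le_sum_abs _ _).trans (Finset.sum_le_sum fun i _ => ?_)
  rw [abs_mul]
  exact mul_le_mul_of_nonneg_left (hu _) (abs_nonneg _)

/-- averaging operator -/
noncomputable def P (z : ι → E n) : Module.End ℝ (E n → ℝ) := T (fun _ => (Fintype.card ι : ℝ)⁻¹) z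

lemma Ppow_bound [Nonempty ι] {z : ι → E n} {u : E n → ℝ} {M : ℝ} (hu : ∀ x, |u x| ≤ M) (k : ℕ) :
    ∀ x, |(P z ^ k) u x| ≤ M := by
  induction k with
  | zero => simpa using hu
  | succ k ih =>
    intro x
    rw [pow_succ', Module.End.mul_apply]
    refine (T_bound ih x).trans (le_of_eq ?_)
    have hN : (0 : ℝ) < Fintype.card ι := by exact_mod_cast Fintype.card_pos
    simp only [abs_of_pos (inv_pos.2 hN), Finset.sum_const, Finset.card_univ, nsmul_eq_mul]
    field_simp

lemma bell_int {p q C : ℝ} {Q : ℝ → ℝ → ℝ} (hQ : IsBellman p q C Q) (hp : 0 < p) (hq : 0 < q)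
    {u v : E n → ℝ} (hu : CC u) (hv : CC v) (hu0 : ∀ x, 0 ≤ u x) (hv0 : ∀ x, 0 ≤ v x) :
    Integrable (fun x => Q (u x) (v x)) := by
  refine Integrable.mono' (((hu.rpow hp).add (hv.rpow hq)).const_mul C).integrable ?_ ?_
  · exact (hQ.2.2.1.comp (hu.1.measurable.prodMk hv.1.measurable)).aestronglyMeasurable
  · refine Filter.Eventually.of_forall fun x => ?_
    rw [Real.norm_eq_abs, abs_of_nonneg (hQ.1 _ _)]
    exact hQ.2.1 _ _ (hu0 x) (hv0 x)

structure Walk (z : ι → E n) (m : ι → ℝ) (σ : ι ≃ ι) : Prop where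
  hz : ∀ i, z (σ i) = - z i
  hm : ∀ i, m (σ i) = m i
  hm1 : ∀ i, |m i| ≤ 1
  hm0 : ∑ i, m i = 0

lemma walk_step [Nonempty ι] {p q C : ℝ} {Q : ℝ → ℝ → ℝ} (hQ : IsBellman p q C Q) (hp : 0 < p) (hq : 0 < q)
    {z : ι → E n} {m : ι → ℝ} {σ : ι ≃ ι} (W : Walk z m σ)
    {u v : E n → ℝ} (hu : CC u) (hv : CC v) (hu0 : ∀ x, 0 ≤ u x) (hv0 : ∀ x, 0 ≤ v x) :
    Fintype.card ι * (∫ x, Q (P z u x) (P z v x)) + |2 * ∫ x, P z (T m z u) x * v x| ≤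
      Fintype.card ι * ∫ x, Q (u x) (v x) := by
  have hN : (0 : ℝ) < Fintype.card ι := by exact_mod_cast Fintype.card_pos
  have hPu : CC (P z u) := T_cc _ z hu
  have hPv : CC (P z v) := T_cc _ z hv
  have hPu0 := T_nonneg (z := z) (c := fun _ => (Fintype.card ι : ℝ)⁻¹) (fun _ => by positivity) hu0
  have hPv0 := T_nonneg (z := z) (c := fun _ => (Fintype.card ι : ℝ)⁻¹) (fun _ => by positivity) hv0
  have hI1 := bell_int hQ hp hq hPu hPv hPu0 hPv0
  have hI2 := bell_int hQ hp hq hu hv hu0 hv0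
  have hI3 : ∀ i, Integrable (fun x => Q (u (x + z i)) (v (x + z i))) := fun i =>
    bell_int hQ hp hq (hu.shift (z i)) (hv.shift (z i)) (fun x => hu0 _) (fun x => hv0 _)
  let R : E n → ℝ := fun x => ∑ i, m i * ((u (x + z i) - P z u x) * (v (x + z i) - P z v x))
  have hRe : ∀ x, R x = T m z (fun y => u y * v y) x - (P z u x * T m z v x + T m z u x * P z v x) := by
    intro x
    simp only [R, T_apply]
    have : ∀ i, m i * ((u (x + z i) - P z u x) * (v (x + z i) - P z v x)) =
      m i * (u (x + z i) * v (x + z i)) - (P z u x * (m i * v (x + z i)) + (m i * u (x + z i)) * P z v x)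
        + m i * (P z u x * P z v x) := fun i => by ring
    simp only [this, Finset.sum_add_distrib, Finset.sum_sub_distrib, ← Finset.mul_sum, ← Finset.sum_mul, W.hm0]
    ring
  have hc1 := T_cc m z (hu.mul hv)
  have hc2 := hPu.mul (T_cc m z hv)
  have hc3 := (T_cc m z hu).mul hPv
  have hRint : Integrable R := by
    have := hc1.integrable.sub (hc2.add hc3).integrable
    exact this.congr (Filter.Eventually.of_forall fun x => (hRe x).symm)
  have hpt : ∀ x, Fintype.card ι * Q (P z u x) (P z v x) + |R x| ≤ ∑ i, Q (u (x + z i)) (v (x + z i)) := by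
    intro x
    have := hQ.jensen (fun i => u (x + z i)) (fun i => v (x + z i)) (fun i => hu0 _) (fun i => hv0 _)
      (P z u x) (P z v x) (by simp [P, T_apply, Finset.mul_sum]) (by simp [P, T_apply, Finset.mul_sum])
    refine le_trans ?_ this
    gcongr
    refine (Finset.abs_sum_le_sum_abs _ _).trans (Finset.sum_le_sum fun i _ => ?_)
    rw [abs_mul, abs_mul]
    exact mul_le_of_le_one_left (by positivity) (W.hm1 i)
  have hint := integral_mono ((hI1.const_mul (Fintype.card ι : ℝ)).add hRint.abs)
    (integrable_finsetSum _ fun i _ => hI3 i) hpt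
  simp only [Pi.add_apply] at hint
  rw [integral_add (hI1.const_mul _) hRint.abs, integral_const_mul,
    integral_finsetSum _ fun i _ => hI3 i] at hint
  have e1 : ∀ i, ∫ x, Q (u (x + z i)) (v (x + z i)) = ∫ x, Q (u x) (v x) := fun i =>
    integral_add_right_eq_self (fun x => Q (u x) (v x)) (z i)
  simp only [e1, Finset.sum_const, Finset.card_univ, nsmul_eq_mul] at hint
  have e2 : ∫ x, R x = - (2 * ∫ x, P z (T m z u) x * v x) := by
    simp only [hRe]
    rw [integral_sub hc1.integrable (hc2.add hc3).integrable, integral_add hc2.integrable hc3.integrable]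
    have h0 : ∫ x, T m z (fun y => u y * v y) x = 0 := by
      simp only [T_apply]
      rw [integral_finsetSum _ (fun i _ => (((hu.mul hv).shift (z i)).const_mul (m i)).integrable)]
      simp only [integral_const_mul]
      have : ∀ i, ∫ x, u (x + z i) * v (x + z i) = ∫ x, u x * v x := fun i =>
        integral_add_right_eq_self (fun x => u x * v x) (z i)
      simp only [this, ← Finset.sum_mul, W.hm0, zero_mul]
    have h1 : ∫ x, P z u x * T m z v x = ∫ x, P z (T m z u) x * v x := by
      rw [← T_symm σ W.hz W.hm hPu hv]
      have := T_comm m (fun _ => (Fintype.card ι : ℝ)⁻¹) z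
      have : T m z (P z u) = P z (T m z u) := congrArg (fun f => f u) this.eq
      rw [this]
    have h2 : ∫ x, T m z u x * P z v x = ∫ x, P z (T m z u) x * v x :=
      (T_symm σ W.hz (fun _ => rfl) (T_cc m z hu) hv).symm
    rw [h0, h1, h2]; ring
  have h3 : |∫ x, R x| ≤ ∫ x, |R x| := abs_integral_le_integral_abs
  rw [e2, abs_neg] at h3
  linarith

lemma walk_sum [Nonempty ι] {p q C : ℝ} {Q : ℝ → ℝ → ℝ} (hQ : IsBellman p q C Q) (hp : 0 < p) (hq : 0 < q)
    {z : ι → E n} {m : ι → ℝ} {σ : ι ≃ ι} (W : Walk z m σ)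
    {f g : E n → ℝ} (hf : CC f) (hg : CC g) (hf0 : ∀ x, 0 ≤ f x) (hg0 : ∀ x, 0 ≤ g x) (K : ℕ) :
    ∑ k ∈ Finset.range K, |∫ x, (P z * T m z * P z ^ (2 * k)) f x * g x| ≤
      Fintype.card ι * C / 2 * ((∫ x, f x ^ p) + ∫ x, g x ^ q) := by
  have hN : (0 : ℝ) < Fintype.card ι := by exact_mod_cast Fintype.card_pos
  have hind : ∀ K : ℕ, Fintype.card ι * (∫ x, Q ((P z ^ K) f x) ((P z ^ K) g x)) +
      2 * ∑ k ∈ Finset.range K, |∫ x, (P z * T m z * P z ^ (2 * k)) f x * g x| ≤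
      Fintype.card ι * ∫ x, Q (f x) (g x) := by
    intro K
    induction K with
    | zero => simp
    | succ k ih =>
      have hs := walk_step hQ hp hq W (Tpow_cc _ z k hf) (Tpow_cc _ z k hg)
        (Tpow_nonneg (c := fun _ => (Fintype.card ι : ℝ)⁻¹) (fun _ => by positivity) hf0 k)
        (Tpow_nonneg (c := fun _ => (Fintype.card ι : ℝ)⁻¹) (fun _ => by positivity) hg0 k)
      have e : ∫ x, P z (T m z ((P z ^ k) f)) x * (P z ^ k) g x =
          ∫ x, (P z * T m z * P z ^ (2 * k)) f x * g x := by
        have hcc : CC (P z (T m z ((P z ^ k) f))) := T_cc _ z (T_cc m z (Tpow_cc _ z k hf))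
        refine (Tpow_symm (c := fun _ => (Fintype.card ι : ℝ)⁻¹) (z := z) σ W.hz (fun _ => rfl) k
          hcc hg).symm.trans ?_
        change ∫ x, (P z ^ k) (P z (T m z ((P z ^ k) f))) x * g x = _
        have hco : P z ^ k * (P z * T m z) = (P z * T m z) * P z ^ k := by
          have h1 : Commute (P z) (T m z) := T_comm _ _ _
          exact (((Commute.refl _).pow_left k).mul_right (h1.pow_left k)).eq
        have : P z * T m z * P z ^ (2 * k) = P z ^ k * (P z * T m z) * P z ^ k := by
          rw [hco, two_mul, pow_add, mul_assoc (P z * T m z)]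
        rw [this]
        rfl
      change Fintype.card ι * (∫ x, Q (P z ((P z ^ k) f) x) (P z ((P z ^ k) g) x)) +
        |2 * ∫ x, P z (T m z ((P z ^ k) f)) x * (P z ^ k) g x| ≤
        Fintype.card ι * ∫ x, Q ((P z ^ k) f x) ((P z ^ k) g x) at hs
      rw [e, abs_mul, abs_two] at hs
      rw [Finset.sum_range_succ, pow_succ']
      simp only [Module.End.mul_apply (P z) (P z ^ k)]
      linarith
  have h1 := hind K
  have h2 : 0 ≤ ∫ x, Q ((P z ^ K) f x) ((P z ^ K) g x) := integral_nonneg fun x => hQ.1 _ _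
  have h3 : ∫ x, Q (f x) (g x) ≤ C * ((∫ x, f x ^ p) + ∫ x, g x ^ q) := by
    rw [← integral_add (hf.rpow hp).integrable (hg.rpow hq).integrable, ← integral_const_mul]
    exact integral_mono (bell_int hQ hp hq hf hg hf0 hg0)
      (((hf.rpow hp).add (hg.rpow hq)).const_mul C).integrable
      fun x => hQ.2.1 _ _ (hf0 x) (hg0 x)
  have h4 : 0 ≤ Fintype.card ι * ∫ x, Q ((P z ^ K) f x) ((P z ^ K) g x) := by positivity
  have h5 := mul_le_mul_of_nonneg_left h3 hN.le
  linarith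

lemma L_cc (z : ι → E n) (m : ι → ℝ) (k : ℕ) {f : E n → ℝ} (hf : CC f) :
    CC ((P z * T m z * P z ^ (2 * k)) f) :=
  T_cc _ z (T_cc m z (Tpow_cc _ z _ hf))

lemma walk_main [Nonempty ι] {p q C : ℝ} {Q : ℝ → ℝ → ℝ} (hQ : IsBellman p q C Q) (hC : 0 < C)
    (hp : 0 < p) (hq : 0 < q)
    {z : ι → E n} {m : ι → ℝ} {σ : ι ≃ ι} (W : Walk z m σ)
    {φ g : E n → ℝ} (hφ : CC φ) (hg : CC g) (hg0 : ∀ x, 0 ≤ g x) {r : ℝ} (hr0 : 0 ≤ r) (hr1 : r < 1) :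
    |∫ x, P z (T m z φ) x * g x| ≤
      Fintype.card ι * C * ((∫ x, |φ x - r * P z (P z φ) x| ^ p) + ∫ x, g x ^ q) := by
  have hN : (0 : ℝ) < Fintype.card ι := by exact_mod_cast Fintype.card_pos
  set f : E n → ℝ := φ - r • (P z ^ 2) φ with hf
  have hfx : ∀ x, f x = φ x - r * P z (P z φ) x := fun x => by
    simp [hf, pow_two]
  have hfc : CC f := by
    have := hφ.add ((Tpow_cc (fun _ => (Fintype.card ι : ℝ)⁻¹) z 2 hφ).const_mul (-r))
    convert this using 1
    ext x; simp [hf, P]; ring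
  set fp : E n → ℝ := fun x => max (f x) 0 with hfp
  set fm : E n → ℝ := fun x => max (-f x) 0 with hfm
  have hfpc : CC fp := hfc.comp (g := fun t => max t 0) (by fun_prop) (by simp)
  have hfmc : CC fm := hfc.comp (g := fun t => max (-t) 0) (by fun_prop) (by simp)
  have hfe : f = fp - fm := by
    ext x
    simp only [hfp, hfm, Pi.sub_apply]
    rcases le_total 0 (f x) with h | h
    · rw [max_eq_left h, max_eq_right (by linarith)]; ring
    · rw [max_eq_right h, max_eq_left (by linarith)]; ring
  let I : ℕ → (E n → ℝ) → ℝ := fun k w => ∫ x, (P z * T m z * P z ^ (2 * k)) w x * g x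
  have hIsub : ∀ k u v, CC u → CC v → I k (u - v) = I k u - I k v := by
    intro k u v hu hv
    simp only [I, map_sub, Pi.sub_apply, sub_mul]
    exact integral_sub ((L_cc z m k hu).mul hg).integrable ((L_cc z m k hv).mul hg).integrable
  have hIsm : ∀ k a u, I k (a • u) = a * I k u := by
    intro k a u
    simp only [I, map_smul, Pi.smul_apply, smul_eq_mul, mul_assoc]
    exact integral_const_mul _ _
  set BD := Fintype.card ι * C * ((∫ x, |f x| ^ p) + ∫ x, g x ^ q) with hBD
  have hIp : ∫ x, fp x ^ p ≤ ∫ x, |f x| ^ p := by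
    refine integral_mono (hfpc.rpow hp).integrable
      ((hfc.comp (g := fun t => |t|) (by fun_prop) (by simp)).rpow hp).integrable fun x => ?_
    exact Real.rpow_le_rpow (le_max_right _ _) (max_le (le_abs_self _) (abs_nonneg _)) hp.le
  have hIm : ∫ x, fm x ^ p ≤ ∫ x, |f x| ^ p := by
    refine integral_mono (hfmc.rpow hp).integrable
      ((hfc.comp (g := fun t => |t|) (by fun_prop) (by simp)).rpow hp).integrable fun x => ?_
    exact Real.rpow_le_rpow (le_max_right _ _) (max_le (neg_le_abs _) (abs_nonneg _)) hp.le
  have hbound : ∀ K, |∑ k ∈ Finset.range K, r ^ k * I k f| ≤ BD := by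
    intro K
    have h1 := walk_sum hQ hp hq W hfpc hg (fun x => le_max_right _ _) hg0 K
    have h2 := walk_sum hQ hp hq W hfmc hg (fun x => le_max_right _ _) hg0 K
    have h3 : |∑ k ∈ Finset.range K, r ^ k * I k f| ≤
        ∑ k ∈ Finset.range K, |I k fp| + ∑ k ∈ Finset.range K, |I k fm| := by
      rw [← Finset.sum_add_distrib]
      refine (Finset.abs_sum_le_sum_abs _ _).trans (Finset.sum_le_sum fun k _ => ?_)
      rw [abs_mul, hfe, hIsub k _ _ hfpc hfmc, abs_of_nonneg (pow_nonneg hr0 k)]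
      refine (mul_le_of_le_one_left (abs_nonneg _) (pow_le_one₀ hr0 hr1.le)).trans (abs_sub _ _)
    have hNC : 0 ≤ Fintype.card ι * C / 2 := by positivity
    have h4 := mul_le_mul_of_nonneg_left hIp hNC
    have h5 := mul_le_mul_of_nonneg_left hIm hNC
    simp only [I] at h3 ⊢
    rw [hBD]
    linarith
  have htel : ∀ K, ∑ k ∈ Finset.range K, r ^ k * I k f = I 0 φ - r ^ K * I K φ := by
    intro K
    induction K with
    | zero => simp
    | succ k ih =>
      have h1 : I k f = I k φ - r * I (k + 1) φ := by
        have hcc : CC (r • (P z ^ 2) φ) :=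
          (Tpow_cc (fun _ => (Fintype.card ι : ℝ)⁻¹) z 2 hφ).const_mul r
        rw [hf, hIsub k _ _ hφ hcc, hIsm]
        congr 2
      rw [Finset.sum_range_succ, ih, h1]; ring
  obtain ⟨M, hM⟩ := hφ.1.bounded_above_of_compact_support hφ.2
  have hIK : ∀ K, |I K φ| ≤ (∑ i, |m i|) * M * ∫ x, g x := by
    intro K
    rw [← integral_const_mul]
    refine abs_integral_le_integral_abs.trans (integral_mono ((L_cc z m K hφ).mul hg).integrable.abs
      (hg.const_mul _).integrable fun x => ?_)
    change |_ * g x| ≤ _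
    rw [abs_mul, abs_of_nonneg (hg0 x)]
    refine mul_le_mul_of_nonneg_right ?_ (hg0 x)
    have h1 := Ppow_bound (z := z) (u := φ) (M := M) (fun x => hM x) (2 * K)
    have h2 := T_bound (c := m) (z := z) h1
    have h3 := Ppow_bound (z := z) h2 1 x
    simpa using h3
  have hlim : Filter.Tendsto (fun K => |I 0 φ - r ^ K * I K φ|) Filter.atTop (nhds |I 0 φ - 0|) := by
    refine (Filter.Tendsto.sub tendsto_const_nhds ?_).abs
    rw [tendsto_zero_iff_abs_tendsto_zero]
    have h0 : Filter.Tendsto (fun K : ℕ => r ^ K * ((∑ i, |m i|) * M * ∫ x, g x)) Filter.atTop (nhds 0) := by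
      simpa using (tendsto_pow_atTop_nhds_zero_of_lt_one hr0 hr1).mul_const ((∑ i, |m i|) * M * ∫ x, g x)
    refine squeeze_zero (fun K => abs_nonneg _) (fun K => ?_) h0
    simp only [Function.comp]
    rw [abs_mul, abs_of_nonneg (pow_nonneg hr0 K)]
    exact mul_le_mul_of_nonneg_left (hIK K) (pow_nonneg hr0 K)
  have hfinal : |I 0 φ - 0| ≤ BD := le_of_tendsto' hlim fun K => by rw [← htel]; exact hbound K
  rw [sub_zero] at hfinal
  simp only [← hfx]
  simpa [I] using hfinal

end CZ

namespace CZ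
variable {n : ℕ} {ι : Type*} [Fintype ι]

/-- second derivative as bilinear form -/
noncomputable def H (φ : E n → ℝ) (x v w : E n) : ℝ := fderiv ℝ (fderiv ℝ φ) x v w

section
variable {φ : E n → ℝ}

lemma contDiff_fderiv' (hφ : ContDiff ℝ (⊤ : ℕ∞) φ) : ContDiff ℝ (⊤ : ℕ∞) (fderiv ℝ φ) :=
  hφ.fderiv_right (by simp)

lemma H_cont (hφ : ContDiff ℝ (⊤ : ℕ∞) φ) (w : E n) : Continuous fun x => H φ x w w := by
  have h := ((contDiff_fderiv' hφ).continuous_fderiv (by simp))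
  unfold H
  fun_prop

lemma H_symm (hφ : ContDiff ℝ (⊤ : ℕ∞) φ) (x v w : E n) : H φ x v w = H φ x w v := by
  have := (hφ.contDiffAt (x := x)).isSymmSndFDerivAt (by simp only [minSmoothness_of_isRCLikeNormedField]; exact WithTop.coe_le_coe.2 (le_top : (2:ℕ∞) ≤ ⊤))
  exact this v w

lemma taylor_int (hφ : ContDiff ℝ (⊤ : ℕ∞) φ) (x w : E n) (h : ℝ) :
    φ (x + h • w) = φ x + h * fderiv ℝ φ x w +
      h ^ 2 * ∫ t in (0:ℝ)..1, (1 - t) * H φ (x + (t * h) • w) w w := by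
  have hline : ∀ t : ℝ, HasDerivAt (fun t : ℝ => x + (t * h) • w) (h • w) t := by
    intro t
    have h1 : HasDerivAt (fun t : ℝ => t * h) h t := by simpa using (hasDerivAt_id t).mul_const h
    exact (h1.smul_const w).const_add x
  have hd1 : ∀ t : ℝ, HasDerivAt (fun t : ℝ => φ (x + (t * h) • w)) (h * fderiv ℝ φ (x + (t * h) • w) w) t := by
    intro t
    have := ((hφ.differentiable (by simp)) (x + (t * h) • w)).hasFDerivAt.comp_hasDerivAt t (hline t)
    rw [map_smul, smul_eq_mul] at this
    exact this
  have hd2 : ∀ t : ℝ, HasDerivAt (fun t : ℝ => fderiv ℝ φ (x + (t * h) • w) w) (h * H φ (x + (t * h) • w) w w) t := by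
    intro t
    have := (((contDiff_fderiv' hφ).differentiable (by simp)) (x + (t * h) • w)).hasFDerivAt.comp_hasDerivAt t (hline t)
    have := this.clm_apply (hasDerivAt_const t w)
    simpa [H] using this
  have hd3 : ∀ t : ℝ, HasDerivAt (fun t : ℝ => (1 - t) * (h * fderiv ℝ φ (x + (t * h) • w) w) + φ (x + (t * h) • w))
      (h ^ 2 * ((1 - t) * H φ (x + (t * h) • w) w w)) t := by
    intro t
    have h0 : HasDerivAt (fun t : ℝ => 1 - t) (-1) t := by simpa using (hasDerivAt_id t).const_sub 1
    have := (h0.mul ((hd2 t).const_mul h)).add (hd1 t)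
    exact this.congr_deriv (by ring)
  have hc : Continuous fun t : ℝ => h ^ 2 * ((1 - t) * H φ (x + (t * h) • w) w w) := by
    have := H_cont hφ w
    have h2 : Continuous fun t : ℝ => H φ (x + (t * h) • w) w w := this.comp (by fun_prop)
    fun_prop
  have := intervalIntegral.integral_eq_sub_of_hasDerivAt (fun t _ => hd3 t) (hc.intervalIntegrable 0 1)
  rw [intervalIntegral.integral_const_mul] at this
  rw [this]
  simp
  ring

/-- remainder integral -/
lemma J_tendsto (hφ : ContDiff ℝ (⊤ : ℕ∞) φ) (x w : E n) : Filter.Tendsto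
    (fun h : ℝ => ∫ t in (0:ℝ)..1, (1 - t) * H φ (x + (t * h) • w) w w) (nhds 0)
    (nhds (1 / 2 * H φ x w w)) := by
  have hc : Continuous fun h : ℝ => ∫ t in (0:ℝ)..1, (1 - t) * H φ (x + (t * h) • w) w w := by
    refine intervalIntegral.continuous_parametric_intervalIntegral_of_continuous' ?_ 0 1
    have := H_cont hφ w
    have h2 : Continuous fun z : ℝ × ℝ => H φ (x + (z.2 * z.1) • w) w w := this.comp (by fun_prop)
    simp only [Function.uncurry_def]
    fun_prop
  have := hc.tendsto 0
  convert this using 2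
  simp only [mul_zero, zero_smul, add_zero, intervalIntegral.integral_mul_const]
  congr 1
  rw [intervalIntegral.integral_sub (by simp) (by simp)]
  simp
  norm_num

lemma H_bound (hφ : ContDiff ℝ (⊤ : ℕ∞) φ) (hs : HasCompactSupport φ) (w : E n) : ∃ M, 0 ≤ M ∧ ∀ x, |H φ x w w| ≤ M := by
  have hcs : HasCompactSupport fun x => H φ x w w := by
    have h1 := (hs.fderiv (𝕜 := ℝ)).fderiv (𝕜 := ℝ)
    exact h1.comp_left (g := fun L => L w w) (by simp)
  obtain ⟨M, hM⟩ := (H_cont hφ w).bounded_above_of_compact_support hcs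
  exact ⟨M, (norm_nonneg _).trans (hM 0), fun x => hM x⟩

lemma J_bound {M : ℝ} (w : E n) (hM : ∀ x, |H φ x w w| ≤ M) (x : E n) (h : ℝ) :
    |∫ t in (0:ℝ)..1, (1 - t) * H φ (x + (t * h) • w) w w| ≤ M := by
  have := intervalIntegral.norm_integral_le_of_norm_le_const (a := 0) (b := 1)
    (f := fun t => (1 - t) * H φ (x + (t * h) • w) w w) (C := M) (by
      intro t ht
      rw [Set.uIoc_of_le zero_le_one] at ht
      rw [Real.norm_eq_abs, abs_mul]
      have h1 : |1 - t| ≤ 1 := by rw [abs_le]; constructor <;> linarith [ht.1, ht.2]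
      exact (mul_le_of_le_one_left (abs_nonneg _) h1).trans (hM _))
  simpa using this

lemma T_expand (hφ : ContDiff ℝ (⊤ : ℕ∞) φ) (c : ι → ℝ) (z : ι → E n) (hz : ∑ i, c i • z i = 0) (x : E n) (h : ℝ) :
    T c (fun i => h • z i) φ x - (∑ i, c i) * φ x =
    h ^ 2 * ∑ i, c i * ∫ t in (0:ℝ)..1, (1 - t) * H φ (x + (t * h) • z i) (z i) (z i) := by
  have h0 : ∑ i, c i * fderiv ℝ φ x (z i) = 0 := by
    have := congrArg (fderiv ℝ φ x) hz
    simpa using this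
  simp only [T_apply, taylor_int hφ x _ h, mul_add, Finset.sum_add_distrib, ← Finset.sum_mul]
  have e1 : ∑ i, c i * (h * fderiv ℝ φ x (z i)) = h * ∑ i, c i * fderiv ℝ φ x (z i) := by
    rw [Finset.mul_sum]; exact Finset.sum_congr rfl fun i _ => by ring
  rw [e1, h0, Finset.mul_sum]
  simp only [mul_left_comm (h ^ 2)]
  ring

lemma T_limit (hφ : ContDiff ℝ (⊤ : ℕ∞) φ) (c : ι → ℝ) (z : ι → E n) (hz : ∑ i, c i • z i = 0) (x : E n) :
    Filter.Tendsto (fun h : ℝ => (h ^ 2)⁻¹ * (T c (fun i => h • z i) φ x - (∑ i, c i) * φ x))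
      (nhdsWithin 0 (Set.Ioi 0)) (nhds (1 / 2 * ∑ i, c i * H φ x (z i) (z i))) := by
  have h1 : Filter.Tendsto (fun h : ℝ => ∑ i, c i * ∫ t in (0:ℝ)..1, (1 - t) * H φ (x + (t * h) • z i) (z i) (z i))
      (nhdsWithin 0 (Set.Ioi 0)) (nhds (∑ i, c i * (1 / 2 * H φ x (z i) (z i)))) :=
    tendsto_finsetSum _ fun i _ => ((J_tendsto hφ x (z i)).mono_left nhdsWithin_le_nhds).const_mul (c i)
  rw [show 1 / 2 * ∑ i, c i * H φ x (z i) (z i) = ∑ i, c i * (1 / 2 * H φ x (z i) (z i)) by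
    rw [Finset.mul_sum]; exact Finset.sum_congr rfl fun i _ => by ring]
  refine h1.congr' ?_
  filter_upwards [self_mem_nhdsWithin] with h hh
  have : h ≠ 0 := ne_of_gt hh
  rw [T_expand hφ c z hz, ← mul_assoc, inv_mul_cancel₀ (pow_ne_zero 2 this), one_mul]

lemma T_bound2 (hφ : ContDiff ℝ (⊤ : ℕ∞) φ) (hs : HasCompactSupport φ) (c : ι → ℝ) (z : ι → E n) (hz : ∑ i, c i • z i = 0) :
    ∃ M, 0 ≤ M ∧ ∀ h x, |T c (fun i => h • z i) φ x - (∑ i, c i) * φ x| ≤ h ^ 2 * M := by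
  choose M hM0 hM using fun i => H_bound hφ hs (z i)
  refine ⟨∑ i, |c i| * M i, Finset.sum_nonneg fun i _ => mul_nonneg (abs_nonneg _) (hM0 i), fun h x => ?_⟩
  rw [T_expand hφ c z hz, abs_mul, abs_of_nonneg (sq_nonneg h)]
  refine mul_le_mul_of_nonneg_left ?_ (sq_nonneg h)
  refine (Finset.abs_sum_le_sum_abs _ _).trans (Finset.sum_le_sum fun i _ => ?_)
  rw [abs_mul]
  exact mul_le_mul_of_nonneg_left (J_bound (z i) (hM i) x h) (abs_nonneg _)

lemma quad_sum (hφ : ContDiff ℝ (⊤ : ℕ∞) φ) (c c' : ι → ℝ) (z : ι → E n) (hz : ∑ i, c i • z i = 0) (x : E n) :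
    ∑ a : ι × ι, (c a.1 * c' a.2) * H φ x (z a.1 + z a.2) (z a.1 + z a.2) =
      (∑ i, c' i) * ∑ i, c i * H φ x (z i) (z i) + (∑ i, c i) * ∑ i, c' i * H φ x (z i) (z i) := by
  have hcross : ∀ v, ∑ i, c i * H φ x v (z i) = 0 := by
    intro v
    have := congrArg (fderiv ℝ (fderiv ℝ φ) x v) hz
    simpa [H] using this
  have e : ∀ i j, (c i * c' j) * H φ x (z i + z j) (z i + z j) =
      c' j * (c i * H φ x (z i) (z i)) + c i * (c' j * H φ x (z j) (z j)) + 2 * c' j * (c i * H φ x (z j) (z i)) := by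
    intro i j
    have h1 : H φ x (z i + z j) (z i + z j) = H φ x (z i) (z i) + H φ x (z i) (z j) + (H φ x (z j) (z i) + H φ x (z j) (z j)) := by
      simp only [H, map_add, add_apply]; ring
    rw [h1, H_symm hφ x (z i) (z j)]; ring
  rw [Fintype.sum_prod_type]
  simp only [e, Finset.sum_add_distrib]
  have e3 : ∑ i, ∑ j, 2 * c' j * (c i * H φ x (z j) (z i)) = 0 := by
    rw [Finset.sum_comm]
    simp only [← Finset.mul_sum, hcross, mul_zero, Finset.sum_const_zero]
  rw [e3]
  simp only [← Finset.mul_sum, ← Finset.sum_mul, add_zero]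

end

lemma T_comp (c c' : ι → ℝ) (z : ι → E n) (u : E n → ℝ) :
    T c z (T c' z u) = T (fun a : ι × ι => c a.1 * c' a.2) (fun a => z a.1 + z a.2) u := by
  ext x
  simp only [T_apply, Fintype.sum_prod_type, Finset.mul_sum]
  refine Finset.sum_congr rfl fun i _ => Finset.sum_congr rfl fun j _ => ?_
  rw [add_assoc]; ring

lemma mom_sum (c c' : ι → ℝ) (z : ι → E n) (hz : ∑ i, c i • z i = 0) (hz' : ∑ i, c' i • z i = 0) :
    ∑ a : ι × ι, (c a.1 * c' a.2) • (z a.1 + z a.2) = 0 := by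
  rw [Fintype.sum_prod_type]
  simp only [smul_add, Finset.sum_add_distrib]
  have h1 : ∑ i, ∑ j, (c i * c' j) • z i = 0 := by
    rw [Finset.sum_comm]
    simp only [mul_comm (c _), mul_smul, ← Finset.smul_sum, hz, smul_zero, Finset.sum_const_zero]
  have h2 : ∑ i, ∑ j, (c i * c' j) • z j = 0 := by
    simp only [mul_smul, ← Finset.smul_sum, hz', smul_zero, Finset.sum_const_zero]
  rw [h1, h2, add_zero]

lemma sum_mul_prod (c c' : ι → ℝ) : ∑ a : ι × ι, (c a.1 * c' a.2) = (∑ i, c i) * ∑ i, c' i := by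
  rw [Fintype.sum_prod_type, Finset.sum_mul_sum]

end CZ

namespace CZ
variable {n : ℕ} {ι : Type*} [Fintype ι]

lemma Walk.mom {z : ι → E n} {m : ι → ℝ} {σ : ι ≃ ι} (W : Walk z m σ) {c : ι → ℝ}
    (hc : ∀ i, c (σ i) = c i) : ∑ i, c i • z i = 0 := by
  have h : ∑ i, c i • z i = - ∑ i, c i • z i := by
    conv_lhs => rw [← Equiv.sum_comp σ]
    simp only [hc, W.hz, smul_neg, Finset.sum_neg_distrib]
  have h2 : (2:ℝ) • ∑ i, c i • z i = 0 := by
    rw [two_smul]; nth_rewrite 1 [h]; simp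
  simpa using h2

lemma Walk.smul {z : ι → E n} {m : ι → ℝ} {σ : ι ≃ ι} (W : Walk z m σ) (h : ℝ) :
    Walk (fun i => h • z i) m σ where
  hz i := by simp [W.hz]
  hm := W.hm
  hm1 := W.hm1
  hm0 := W.hm0

lemma T_comp_smul (c c' : ι → ℝ) (z : ι → E n) (u : E n → ℝ) (h : ℝ) :
    T c (fun i => h • z i) (T c' (fun i => h • z i) u) =
      T (fun a : ι × ι => c a.1 * c' a.2) (fun a => h • (z a.1 + z a.2)) u := by
  rw [T_comp]; simp only [smul_add]

lemma limit_ineq [Nonempty ι] {p q C : ℝ} {Q : ℝ → ℝ → ℝ} (hQ : IsBellman p q C Q) (hC : 0 < C)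
    (hp : 0 < p) (hq : 0 < q) {z : ι → E n} {m : ι → ℝ} {σ : ι ≃ ι} (W : Walk z m σ)
    {φ g : E n → ℝ} (hφ : ContDiff ℝ (⊤ : ℕ∞) φ) (hs : HasCompactSupport φ)
    (hg : CC g) (hg0 : ∀ x, 0 ≤ g x) :
    |∫ x, (1 / 2 * ∑ i, m i * H φ x (z i) (z i)) * g x| ≤ Fintype.card ι * C *
      ((∫ x, |φ x - (Fintype.card ι : ℝ)⁻¹ * ∑ i, H φ x (z i) (z i)| ^ p) + ∫ x, g x ^ q) := by
  have hN : (0 : ℝ) < Fintype.card ι := by exact_mod_cast Fintype.card_pos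
  set c : ι → ℝ := fun _ => (Fintype.card ι : ℝ)⁻¹ with hcdef
  have hcs : ∑ i, c i = 1 := by
    simp only [hcdef, Finset.sum_const, Finset.card_univ, nsmul_eq_mul]; field_simp
  have hzc : ∑ i, c i • z i = 0 := W.mom (fun _ => rfl)
  have hzm : ∑ i, m i • z i = 0 := W.mom W.hm
  set zz : ι × ι → E n := fun a => z a.1 + z a.2 with hzz
  set c1 : ι × ι → ℝ := fun a => c a.1 * m a.2 with hc1
  set c2 : ι × ι → ℝ := fun a => c a.1 * c a.2 with hc2
  have m1 : ∑ a, c1 a • zz a = 0 := mom_sum c m z hzc hzm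
  have m2 : ∑ a, c2 a • zz a = 0 := mom_sum c c z hzc hzc
  have s1 : ∑ a, c1 a = 0 := by rw [hc1, sum_mul_prod, W.hm0, mul_zero]
  have s2 : ∑ a, c2 a = 1 := by rw [hc2, sum_mul_prod, hcs, mul_one]
  have cφ : CC φ := ⟨hφ.continuous, hs⟩
  -- pointwise limits
  have l1 : ∀ x, Filter.Tendsto (fun h : ℝ => (h ^ 2)⁻¹ * T c1 (fun i => h • zz i) φ x)
      (nhdsWithin 0 (Set.Ioi 0)) (nhds (1 / 2 * ∑ i, m i * H φ x (z i) (z i))) := by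
    intro x
    have := T_limit hφ c1 zz m1 x
    rw [quad_sum hφ c m z hzc x, W.hm0, hcs, s1] at this
    simpa using this
  have l2 : ∀ x, Filter.Tendsto (fun h : ℝ => (h ^ 2)⁻¹ * (T c2 (fun i => h • zz i) φ x - φ x))
      (nhdsWithin 0 (Set.Ioi 0)) (nhds ((Fintype.card ι : ℝ)⁻¹ * ∑ i, H φ x (z i) (z i))) := by
    intro x
    have := T_limit hφ c2 zz m2 x
    rw [quad_sum hφ c c z hzc x, hcs, s2] at this
    simp only [one_mul] at this
    convert this using 2
    rw [hcdef, ← Finset.mul_sum]; ring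
  obtain ⟨M1, hM10, hM1⟩ := T_bound2 hφ hs c1 zz m1
  obtain ⟨M2, hM20, hM2⟩ := T_bound2 hφ hs c2 zz m2
  rw [s1] at hM1
  rw [s2] at hM2
  simp only [zero_mul, sub_zero] at hM1
  simp only [one_mul] at hM2
  obtain ⟨M0, hM0⟩ := hφ.continuous.bounded_above_of_compact_support hs
  have l3 : ∀ x, Filter.Tendsto (fun h : ℝ => T c2 (fun i => h • zz i) φ x)
      (nhdsWithin 0 (Set.Ioi 0)) (nhds (φ x)) := by
    intro x
    rw [tendsto_iff_norm_sub_tendsto_zero]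
    refine squeeze_zero (fun _ => norm_nonneg _) (fun h => hM2 h x) ?_
    have : Filter.Tendsto (fun h : ℝ => h ^ 2 * M2) (nhds 0) (nhds (0 ^ 2 * M2)) :=
      ((continuous_pow 2).mul continuous_const).tendsto 0
    simpa using this.mono_left nhdsWithin_le_nhds
  set Fh : ℝ → E n → ℝ := fun h x => T c2 (fun i => h • zz i) φ x -
    (h ^ 2)⁻¹ * (T c2 (fun i => h • zz i) φ x - φ x) with hFh
  have cT2 : ∀ h : ℝ, CC (T c2 (fun i => h • zz i) φ) := fun h => T_cc _ _ cφ
  have hmem : ∀ᶠ h : ℝ in nhdsWithin 0 (Set.Ioi 0), 0 < h ∧ h < 1 := by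
    filter_upwards [Ioo_mem_nhdsGT (zero_lt_one (α := ℝ))] with h hh using hh
  -- the inequality for each h
  have key : ∀ᶠ h : ℝ in nhdsWithin 0 (Set.Ioi 0),
      |∫ x, ((h ^ 2)⁻¹ * T c1 (fun i => h • zz i) φ x) * g x| ≤ Fintype.card ι * C *
        ((∫ x, |Fh h x| ^ p) + ∫ x, g x ^ q) := by
    filter_upwards [hmem] with h hh
    have hh2 : h ^ 2 ≠ 0 := pow_ne_zero 2 hh.1.ne'
    have := walk_main hQ hC hp hq (W.smul h) (cφ.const_mul (h ^ 2)⁻¹) hg hg0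
      (r := 1 - h ^ 2) (by nlinarith [hh.1, hh.2]) (by nlinarith [hh.1, hh.2])
    have e0 : (fun x => (h ^ 2)⁻¹ * φ x) = (h ^ 2)⁻¹ • φ := rfl
    rw [e0] at this
    simp only [P, map_smul, T_comp_smul, Pi.smul_apply, smul_eq_mul] at this
    refine this.trans (le_of_eq ?_)
    congr 2
    refine integral_congr_ae (Filter.Eventually.of_forall fun x => ?_)
    simp only [hFh]
    congr 2
    change (h ^ 2)⁻¹ * φ x - (1 - h ^ 2) * ((h ^ 2)⁻¹ * T c2 (fun i => h • zz i) φ x) = _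
    have hk := inv_mul_cancel₀ hh2
    linear_combination (T c2 (fun i => h • zz i) φ x) * hk
  -- limits of both sides
  have L1 : Filter.Tendsto (fun h : ℝ => ∫ x, ((h ^ 2)⁻¹ * T c1 (fun i => h • zz i) φ x) * g x)
      (nhdsWithin 0 (Set.Ioi 0)) (nhds (∫ x, (1 / 2 * ∑ i, m i * H φ x (z i) (z i)) * g x)) := by
    refine tendsto_integral_filter_of_dominated_convergence (fun x => M1 * g x) ?_ ?_ ?_ ?_
    · exact Filter.Eventually.of_forall fun h =>
        (((T_cc c1 (fun i => h • zz i) cφ).const_mul (h ^ 2)⁻¹).mul hg).integrable.aestronglyMeasurable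
    · filter_upwards [hmem] with h hh
      refine Filter.Eventually.of_forall fun x => ?_
      rw [Real.norm_eq_abs, abs_mul, abs_of_nonneg (hg0 x), abs_mul, abs_of_nonneg (by positivity)]
      refine mul_le_mul_of_nonneg_right ?_ (hg0 x)
      rw [inv_mul_le_iff₀ (pow_pos hh.1 2)]
      exact hM1 h x
    · exact (hg.const_mul M1).integrable
    · exact Filter.Eventually.of_forall fun x => (l1 x).mul_const (g x)
  obtain ⟨R, hR⟩ := hs.isCompact.isBounded.subset_closedBall 0
  have hS : ∀ a, ‖zz a‖ ≤ ∑ a, ‖zz a‖ := fun a =>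
    Finset.single_le_sum (f := fun a => ‖zz a‖) (fun _ _ => norm_nonneg _) (Finset.mem_univ a)
  set S := ∑ a, ‖zz a‖
  have hS0 : 0 ≤ S := Finset.sum_nonneg fun _ _ => norm_nonneg _
  have hout : ∀ x, R < ‖x‖ → φ x = 0 := by
    intro x hx
    refine image_eq_zero_of_notMem_tsupport fun hx' => ?_
    have := hR hx'
    rw [mem_closedBall_zero_iff] at this
    linarith
  have L2 : Filter.Tendsto (fun h : ℝ => ∫ x, |Fh h x| ^ p)
      (nhdsWithin 0 (Set.Ioi 0)) (nhds (∫ x, |φ x - (Fintype.card ι : ℝ)⁻¹ * ∑ i, H φ x (z i) (z i)| ^ p)) := by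
    refine tendsto_integral_filter_of_dominated_convergence
      (fun x => (Metric.closedBall (0 : E n) (R + S)).indicator (fun _ => (M0 + M2 + M2) ^ p) x) ?_ ?_ ?_ ?_
    · refine Filter.Eventually.of_forall fun h => ?_
      have hc : Continuous (Fh h) :=
        (cT2 h).1.sub (continuous_const.mul ((cT2 h).1.sub hφ.continuous))
      exact ((Real.continuous_rpow_const hp.le).comp hc.abs).aestronglyMeasurable
    · filter_upwards [hmem] with h hh
      refine Filter.Eventually.of_forall fun x => ?_
      rw [Real.norm_eq_abs, abs_of_nonneg (by positivity)]
      by_cases hx : x ∈ Metric.closedBall (0 : E n) (R + S)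
      · rw [Set.indicator_of_mem hx]
        refine Real.rpow_le_rpow (abs_nonneg _) ?_ hp.le
        have h1 := hM2 h x
        have h2 : |φ x| ≤ M0 := hM0 x
        have h3 : |(h ^ 2)⁻¹ * (T c2 (fun i => h • zz i) φ x - φ x)| ≤ M2 := by
          rw [abs_mul, abs_of_nonneg (by positivity : 0 ≤ (h ^ 2)⁻¹), inv_mul_le_iff₀ (pow_pos hh.1 2)]
          exact h1
        have h4 : h ^ 2 * M2 ≤ M2 := mul_le_of_le_one_left hM20 (by nlinarith [hh.1, hh.2])
        simp only [hFh]
        rw [abs_le] at *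
        constructor <;> linarith [h1.1, h1.2, h2.1, h2.2, h3.1, h3.2]
      · rw [Set.indicator_of_notMem hx]
        rw [mem_closedBall_zero_iff, not_le] at hx
        have e1 : φ x = 0 := hout x (by linarith)
        have e2 : T c2 (fun i => h • zz i) φ x = 0 := by
          rw [T_apply]
          refine Finset.sum_eq_zero fun a _ => ?_
          rw [hout, mul_zero]
          have h5 : ‖h • zz a‖ ≤ S := by
            rw [norm_smul, Real.norm_eq_abs, abs_of_pos hh.1]
            exact (mul_le_of_le_one_left (norm_nonneg _) hh.2.le).trans (hS a)
          have h6 : ‖x‖ ≤ ‖x + h • zz a‖ + ‖h • zz a‖ := by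
            have := norm_sub_le (x + h • zz a) (h • zz a)
            simpa using this
          linarith
        simp only [hFh, e1, e2]
        simp [Real.zero_rpow hp.ne']
    · exact (integrable_indicator_iff measurableSet_closedBall).2
        (integrableOn_const (measure_closedBall_lt_top.ne))
    · refine Filter.Eventually.of_forall fun x => ?_
      exact ((Real.continuous_rpow_const hp.le).tendsto _).comp (((l3 x).sub (l2 x)).abs)
  exact le_of_tendsto_of_tendsto L1.abs ((L2.add_const _).const_mul _) key

end CZ

namespace CZ
variable {n : ℕ}

abbrev Idx (n : ℕ) := (Fin n × Fin n) × (Bool × Bool)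
noncomputable def sg (b : Bool) : ℝ := if b then 1 else -1
lemma sg_not (b : Bool) : sg (!b) = - sg b := by cases b <;> simp [sg]
noncomputable def e (a : Fin n) : E n := EuclideanSpace.single a 1
noncomputable def zc (i : Idx n) : E n := sg i.2.1 • e i.1.1 + sg i.2.2 • e i.1.2
def flip (n : ℕ) : Idx n ≃ Idx n :=
  Equiv.prodCongr (Equiv.refl _) (Equiv.prodCongr Equiv.boolNot Equiv.boolNot)
noncomputable def mc (i j : Fin n) (k : Idx n) : ℝ :=
  if k.1 = (i, j) then sg k.2.1 * sg k.2.2 else 0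

lemma walk_c (i j : Fin n) : Walk zc (mc i j) (flip n) where
  hz k := by simp [zc, flip, sg_not]; abel
  hm k := by simp [mc, flip, sg_not]
  hm1 k := by
    unfold mc sg
    split_ifs <;> simp
  hm0 := by
    rw [Fintype.sum_prod_type]
    simp [mc, sg, Fintype.sum_prod_type]

lemma H_lin (φ : E n → ℝ) (hφ : ContDiff ℝ (⊤ : ℕ∞) φ) (x v w : E n) (s t : ℝ) :
    H φ x (s • v + t • w) (s • v + t • w) = s ^ 2 * H φ x v v + t ^ 2 * H φ x w w + 2 * s * t * H φ x v w := by
  have := H_symm hφ x w v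
  unfold H at *
  simp only [map_add, map_smul, add_apply, smul_apply, smul_eq_mul, this]
  ring

lemma sum_m (φ : E n → ℝ) (hφ : ContDiff ℝ (⊤ : ℕ∞) φ) (x : E n) (i j : Fin n) :
    1 / 2 * ∑ k, mc i j k * H φ x (zc k) (zc k) = 4 * H φ x (e i) (e j) := by
  rw [Fintype.sum_prod_type, Finset.sum_eq_single (i, j)]
  · simp only [mc, zc, H_lin φ hφ, Fintype.sum_prod_type, if_true, Fintype.sum_bool, sg, Bool.false_eq_true, if_false]
    ring
  · intro b _ hb
    simp [mc, hb]
  · simp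

lemma sum_1 (φ : E n → ℝ) (hφ : ContDiff ℝ (⊤ : ℕ∞) φ) (x : E n) :
    ∑ k : Idx n, H φ x (zc k) (zc k) = 8 * n * ∑ i, H φ x (e i) (e i) := by
  have h : ∀ a b : Fin n, ∑ y : Bool × Bool, H φ x (zc ((a, b), y)) (zc ((a, b), y)) =
      4 * H φ x (e a) (e a) + 4 * H φ x (e b) (e b) := by
    intro a b
    simp only [zc, H_lin φ hφ, Fintype.sum_prod_type, if_true, Fintype.sum_bool, sg, Bool.false_eq_true, if_false]
    ring
  rw [Fintype.sum_prod_type, Fintype.sum_prod_type]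
  simp only [h, Finset.sum_add_distrib, ← Finset.mul_sum]
  simp only [Finset.sum_const, Finset.card_univ, Fintype.card_fin, nsmul_eq_mul, ← Finset.mul_sum]
  ring

/-- second derivative bound -/
lemma second_bound (n : ℕ) (hn : 1 ≤ n) (p : ℝ) (hp : 1 < p) : ∃ K : ℝ, 0 < K ∧
    ∀ φ : E n → ℝ, ContDiff ℝ (⊤ : ℕ∞) φ → HasCompactSupport φ → ∀ i j : Fin n,
      ∫ x, |H φ x (e i) (e j)| ^ p ≤ K * ∫ x, |φ x - 2 / n * ∑ a, H φ x (e a) (e a)| ^ p := by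
  set q := p.conjExponent with hqdef
  have hpq : p.HolderConjugate q := Real.HolderConjugate.conjExponent hp
  obtain ⟨Q, C, hC, hQ⟩ := bellman hpq
  have hn0 : (0:ℝ) < n := by exact_mod_cast hn
  have : NeZero n := ⟨by omega⟩
  set N : ℝ := (Fintype.card (Idx n) : ℝ) with hN
  have hNv : N = 4 * n ^ 2 := by simp [hN]; ring
  have hN0 : 0 < N := by rw [hNv]; positivity
  have hNC : 0 < N * C := mul_pos hN0 hC
  have hq1 : 1 < q := hpq.symm.lt
  set μ : ℝ := (1 / (N * C)) ^ (1 / (q - 1)) with hμ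
  have hμ0 : 0 < μ := by positivity
  have hμq : N * C * μ ^ q = μ := by
    have : μ ^ (q - 1) = 1 / (N * C) := by
      rw [hμ, ← Real.rpow_mul (by positivity), one_div_mul_cancel (by linarith), Real.rpow_one]
    have h2 : μ ^ q = μ ^ (q - 1) * μ := by
      rw [← Real.rpow_add_one hμ0.ne']; congr 1; ring
    rw [h2, this]; field_simp
  refine ⟨2 * (N * C / (3 * μ)), by positivity, fun φ hφ hs i j => ?_⟩
  have cH : CC fun x => H φ x (e i) (e j) := by
    refine ⟨?_, ?_⟩
    · have h := ((contDiff_fderiv' hφ).continuous_fderiv (by simp))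
      unfold H
      fun_prop
    · have h1 := (hs.fderiv (𝕜 := ℝ)).fderiv (𝕜 := ℝ)
      exact h1.comp_left (g := fun L => L (e i) (e j)) (by simp)
  set F := ∫ x, |φ x - 2 / n * ∑ a, H φ x (e a) (e a)| ^ p with hF
  have main : ∀ s : ℝ, (s = 1 ∨ s = -1) →
      ∫ x, (max (s * H φ x (e i) (e j)) 0) ^ p ≤ N * C / (3 * μ) * F := by
    intro s hs1
    set a : E n → ℝ := fun x => s * H φ x (e i) (e j) with ha
    have ca : CC a := cH.const_mul s
    have cm : CC fun x => max (a x) 0 := ca.comp (g := fun t => max t 0) (by fun_prop) (by simp)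
    have cg : CC fun x => μ * (max (a x) 0) ^ (p - 1) := (cm.rpow (by linarith)).const_mul μ
    have := limit_ineq hQ hC (by linarith) (by linarith) (walk_c i j) hφ hs cg
      (fun x => by positivity)
    simp only [sum_m φ hφ, sum_1 φ hφ] at this
    rw [← hN] at this
    have e1 : ∫ x, 4 * H φ x (e i) (e j) * (μ * (max (a x) 0) ^ (p - 1)) =
        s * (4 * μ * ∫ x, (max (a x) 0) ^ p) := by
      rw [← integral_const_mul, ← integral_const_mul]
      refine integral_congr_ae (Filter.Eventually.of_forall fun x => ?_)
      have hsa : H φ x (e i) (e j) = s * a x := by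
        rcases hs1 with rfl | rfl <;> simp [ha]
      have hap : a x * (max (a x) 0) ^ (p - 1) = (max (a x) 0) ^ p := by
        rcases le_or_gt (a x) 0 with h | h
        · rw [max_eq_right h, Real.zero_rpow (by linarith), Real.zero_rpow (by linarith), mul_zero]
        · rw [max_eq_left h.le, mul_comm, ← Real.rpow_add_one h.ne']; congr 1; ring
      simp only [hsa, ← hap]; ring
    have e2 : ∫ x, (μ * (max (a x) 0) ^ (p - 1)) ^ q = μ ^ q * ∫ x, (max (a x) 0) ^ p := by
      rw [← integral_const_mul]
      refine integral_congr_ae (Filter.Eventually.of_forall fun x => ?_)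
      simp only
      rw [Real.mul_rpow hμ0.le (by positivity), ← Real.rpow_mul (le_max_right (a x) 0),
        hpq.sub_one_mul_conj]
    have e3 : ∀ x, N⁻¹ * (8 * n * ∑ a, H φ x (e a) (e a)) = 2 / n * ∑ a, H φ x (e a) (e a) := by
      intro x; rw [hNv]; field_simp; ring
    rw [e1, e2] at this
    simp only [e3] at this
    rw [← hF] at this
    set I := ∫ x, (max (a x) 0) ^ p
    have hI : 0 ≤ I := integral_nonneg fun x => by positivity
    have habs : |s * (4 * μ * I)| = 4 * μ * I := by
      rw [abs_mul, abs_of_nonneg (show 0 ≤ 4 * μ * I by positivity)]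
      rcases hs1 with rfl | rfl <;> simp
    rw [habs] at this
    have h5 : 3 * μ * I ≤ N * C * F := by
      have : N * C * (F + μ ^ q * I) = N * C * F + μ * I := by rw [mul_add, ← mul_assoc, hμq]
      linarith
    rw [div_mul_eq_mul_div, le_div_iff₀ (by positivity)]
    linarith
  have m1 := main 1 (Or.inl rfl)
  have m2 := main (-1) (Or.inr rfl)
  have cc : ∀ s : ℝ, CC fun x => (max (s * H φ x (e i) (e j)) 0) ^ p := fun s =>
    ((cH.const_mul s).comp (g := fun t => max t 0) (by fun_prop) (by simp)).rpow (by linarith)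
  have es : ∫ x, |H φ x (e i) (e j)| ^ p = (∫ x, (max (1 * H φ x (e i) (e j)) 0) ^ p) +
      ∫ x, (max (-1 * H φ x (e i) (e j)) 0) ^ p := by
    rw [← integral_add (cc 1).integrable (cc (-1)).integrable]
    refine integral_congr_ae (Filter.Eventually.of_forall fun x => ?_)
    simp only
    rcases le_total 0 (H φ x (e i) (e j)) with h | h
    · rw [abs_of_nonneg h, one_mul, max_eq_left h, max_eq_right (by linarith), Real.zero_rpow (by linarith), add_zero]
    · rw [abs_of_nonpos h, one_mul, max_eq_right h, max_eq_left (by linarith), Real.zero_rpow (by linarith), zero_add, neg_one_mul]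
  rw [es]
  linarith

end CZ

namespace CZ
variable {n : ℕ}

lemma lp_nonneg (p : ℝ) (f : E n → ℝ) : 0 ≤ _root_.lpNorm p f :=
  Real.rpow_nonneg (integral_nonneg fun x => by positivity) _

lemma CC.abs_rpow {u : E n → ℝ} (h : CC u) {p : ℝ} (hp : 0 < p) : CC (fun x => |u x| ^ p) :=
  h.comp (g := fun t => |t| ^ p) ((Real.continuous_rpow_const hp.le).comp continuous_abs)
    (by simp [Real.zero_rpow hp.ne'])

lemma lp_mono {p : ℝ} (hp : 1 < p) {f g : E n → ℝ} (hg : CC g) (h : ∀ x, |f x| ≤ |g x|) :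
    _root_.lpNorm p f ≤ _root_.lpNorm p g := by
  refine Real.rpow_le_rpow (integral_nonneg fun x => by positivity) ?_ (by positivity)
  refine integral_mono_of_nonneg (Filter.Eventually.of_forall fun x => by positivity)
    (hg.abs_rpow (by linarith)).integrable (Filter.Eventually.of_forall fun x => ?_)
  exact Real.rpow_le_rpow (abs_nonneg _) (h x) (by linarith)

lemma lp_smul {p : ℝ} (hp : 1 < p) (c : ℝ) (f : E n → ℝ) :
    _root_.lpNorm p (fun x => c * f x) = |c| * _root_.lpNorm p f := by
  unfold _root_.lpNorm
  simp only [abs_mul, Real.mul_rpow (abs_nonneg _) (abs_nonneg _), integral_const_mul]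
  rw [Real.mul_rpow (by positivity) (integral_nonneg fun x => by positivity),
    ← Real.rpow_mul (abs_nonneg c), mul_one_div_cancel (by linarith), Real.rpow_one]

lemma CC.memLp {u : E n → ℝ} (h : CC u) (p : ENNReal) : MemLp u p := h.1.memLp_of_hasCompactSupport h.2

lemma lp_eq {p : ℝ} (hp : 1 < p) {f : E n → ℝ} (hf : CC f) :
    _root_.lpNorm p f = (eLpNorm f (ENNReal.ofReal p) volume).toReal := by
  rw [(hf.memLp (ENNReal.ofReal p)).eLpNorm_eq_integral_rpow_norm (by rw [ne_eq, ENNReal.ofReal_eq_zero]; linarith) ENNReal.ofReal_ne_top]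
  rw [ENNReal.toReal_ofReal (Real.rpow_nonneg (integral_nonneg fun x => by positivity) _),
    ENNReal.toReal_ofReal (by linarith : (0:ℝ) ≤ p)]
  simp [_root_.lpNorm]

lemma lp_add {p : ℝ} (hp : 1 < p) {f g : E n → ℝ} (hf : CC f) (hg : CC g) :
    _root_.lpNorm p (fun x => f x + g x) ≤ _root_.lpNorm p f + _root_.lpNorm p g := by
  rw [lp_eq hp hf, lp_eq hp hg, lp_eq hp (hf.add hg), ← ENNReal.toReal_add (hf.memLp _).2.ne (hg.memLp _).2.ne]
  refine ENNReal.toReal_mono (ENNReal.add_ne_top.2 ⟨(hf.memLp _).2.ne, (hg.memLp _).2.ne⟩) ?_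
  exact eLpNorm_add_le hf.1.aestronglyMeasurable hg.1.aestronglyMeasurable
    (by rw [← ENNReal.ofReal_one]; exact ENNReal.ofReal_le_ofReal hp.le)

lemma lp_sum {p : ℝ} (hp : 1 < p) {α : Type*} (s : Finset α) {f : α → E n → ℝ} (hf : ∀ a, CC (f a)) :
    _root_.lpNorm p (fun x => ∑ a ∈ s, f a x) ≤ ∑ a ∈ s, _root_.lpNorm p (f a) := by
  classical
  induction s using Finset.induction_on with
  | empty =>
    simp only [Finset.sum_empty]
    have := lp_smul hp 0 (fun _ : E n => (0:ℝ))
    simp at this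
    exact this.le
  | insert a s ha ih =>
    simp only [Finset.sum_insert ha]
    exact (lp_add hp (hf a) (CC.sum s hf)).trans (by linarith)

lemma lp_shift {p : ℝ} (f : E n → ℝ) (z : E n) :
    _root_.lpNorm p (fun x => f (x + z)) = _root_.lpNorm p f := by
  unfold _root_.lpNorm
  rw [integral_add_right_eq_self (fun x => |f x| ^ p) z]

lemma lp_abs {p : ℝ} (f : E n → ℝ) : _root_.lpNorm p (fun x => |f x|) = _root_.lpNorm p f := by
  simp [_root_.lpNorm]

lemma H_cc {φ : E n → ℝ} (hφ : ContDiff ℝ (⊤ : ℕ∞) φ) (hs : HasCompactSupport φ) (v w : E n) :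
    CC fun x => H φ x v w := by
  refine ⟨?_, ?_⟩
  · have h := ((contDiff_fderiv' hφ).continuous_fderiv (by simp))
    unfold H
    fun_prop
  · have h1 := (hs.fderiv (𝕜 := ℝ)).fderiv (𝕜 := ℝ)
    exact h1.comp_left (g := fun L => L v w) (by simp)

lemma D_cc {φ : E n → ℝ} (hφ : ContDiff ℝ (⊤ : ℕ∞) φ) (hs : HasCompactSupport φ) (v : E n) :
    CC fun x => fderiv ℝ φ x v := by
  refine ⟨?_, ?_⟩
  · have h := (hφ.continuous_fderiv (by simp))
    fun_prop
  · have h1 := hs.fderiv (𝕜 := ℝ)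
    exact h1.comp_left (g := fun L => L v) (by simp)

/-- Jensen and Tonelli for the Taylor remainder -/
lemma J_lp {p : ℝ} (hp : 1 < p) {u : E n → ℝ} (hu : CC u) (w : E n) :
    _root_.lpNorm p (fun x => ∫ t in (0:ℝ)..1, (1 - t) * u (x + (t * 1) • w)) ≤ _root_.lpNorm p u := by
  have hp0 : 0 < p := by linarith
  set ν : Measure ℝ := volume.restrict (Set.Ioc 0 1) with hν
  have hprob : IsProbabilityMeasure ν := ⟨by simp [hν]⟩
  have hcu := (hu.abs_rpow hp0).1
  have hcj : Continuous fun z : E n × ℝ => |u (z.1 + (z.2 * 1) • w)| ^ p :=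
    hcu.comp (f := fun z : E n × ℝ => z.1 + (z.2 * 1) • w) (by fun_prop)
  have hI : Integrable (fun z : E n × ℝ => |u (z.1 + (z.2 * 1) • w)| ^ p) (volume.prod ν) := by
    rw [integrable_prod_iff' hcj.aestronglyMeasurable]
    refine ⟨Filter.Eventually.of_forall fun t => ((hu.abs_rpow hp0).shift ((t * 1) • w)).integrable, ?_⟩
    have : ∀ t : ℝ, ∫ x, ‖|u (x + (t * 1) • w)| ^ p‖ = ∫ x, |u x| ^ p := by
      intro t
      rw [integral_add_right_eq_self (fun x => ‖|u x| ^ p‖) ((t * 1) • w)]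
      refine integral_congr_ae (Filter.Eventually.of_forall fun x => ?_)
      simp only [Real.norm_eq_abs]
      rw [abs_of_nonneg (by positivity)]
    simp only [this]
    exact integrable_const _
  refine Real.rpow_le_rpow (integral_nonneg fun x => by positivity) ?_ (by positivity)
  have hpt : ∀ x, |∫ t in (0:ℝ)..1, (1 - t) * u (x + (t * 1) • w)| ^ p ≤
      ∫ t, |u (x + (t * 1) • w)| ^ p ∂ν := by
    intro x
    have hc1 : Continuous fun t : ℝ => |u (x + (t * 1) • w)| :=
      (continuous_abs.comp hu.1).comp (f := fun t : ℝ => x + (t * 1) • w) (by fun_prop)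
    have hc2 : Continuous fun t : ℝ => |u (x + (t * 1) • w)| ^ p :=
      hcu.comp (f := fun t : ℝ => x + (t * 1) • w) (by fun_prop)
    have i1 : Integrable (fun t : ℝ => |u (x + (t * 1) • w)|) ν :=
      (hc1.integrableOn_Icc (a := 0) (b := 1)).mono_set Set.Ioc_subset_Icc_self
    have i2 : Integrable (fun t : ℝ => |u (x + (t * 1) • w)| ^ p) ν :=
      (hc2.integrableOn_Icc (a := 0) (b := 1)).mono_set Set.Ioc_subset_Icc_self
    have h1 : |∫ t in (0:ℝ)..1, (1 - t) * u (x + (t * 1) • w)| ≤ ∫ t, |u (x + (t * 1) • w)| ∂ν := by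
      rw [intervalIntegral.integral_of_le zero_le_one, ← hν]
      refine norm_integral_le_of_norm_le (f := fun t => (1 - t) * u (x + (t * 1) • w)) i1 ?_
      rw [hν]
      filter_upwards [ae_restrict_mem measurableSet_Ioc] with t ht
      rw [Real.norm_eq_abs, abs_mul]
      have h1 : |1 - t| ≤ 1 := by rw [abs_le]; constructor <;> linarith [ht.1, ht.2]
      exact mul_le_of_le_one_left (abs_nonneg _) h1
    refine (Real.rpow_le_rpow (abs_nonneg _) h1 hp0.le).trans ?_
    exact (convexOn_rpow hp.le).map_integral_le (Real.continuous_rpow_const hp0.le).continuousOn isClosed_Ici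
      (Filter.Eventually.of_forall fun t => Set.mem_Ici.2 (abs_nonneg _)) i1 i2
  calc ∫ x, |∫ t in (0:ℝ)..1, (1 - t) * u (x + (t * 1) • w)| ^ p
      ≤ ∫ x, ∫ t, |u (x + (t * 1) • w)| ^ p ∂ν :=
        integral_mono_of_nonneg (Filter.Eventually.of_forall fun x => by positivity)
          hI.integral_prod_left (Filter.Eventually.of_forall hpt)
    _ = ∫ t, (∫ x, |u (x + (t * 1) • w)| ^ p) ∂ν := integral_integral_swap hI
    _ = ∫ t, (∫ x, |u x| ^ p) ∂ν := by
        refine integral_congr_ae (Filter.Eventually.of_forall fun t => ?_)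
        exact integral_add_right_eq_self (fun x => |u x| ^ p) ((t * 1) • w)
    _ = ∫ x, |u x| ^ p := by simp

lemma grad_lp {p : ℝ} (hp : 1 < p) {φ : E n → ℝ} (hφ : ContDiff ℝ (⊤ : ℕ∞) φ) (hs : HasCompactSupport φ)
    (w : E n) : _root_.lpNorm p (fun x => fderiv ℝ φ x w) ≤
      2 * _root_.lpNorm p φ + _root_.lpNorm p (fun x => H φ x w w) := by
  have cφ : CC φ := ⟨hφ.continuous, hs⟩
  have cD := D_cc hφ hs w
  have hJ := J_lp hp (H_cc hφ hs w w) w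
  set J : E n → ℝ := fun x => ∫ t in (0:ℝ)..1, (1 - t) * H φ (x + (t * 1) • w) w w
  have eJ : ∀ x, J x = φ (x + w) + (-1 * φ x + -1 * fderiv ℝ φ x w) := by
    intro x
    have := taylor_int hφ x w 1
    simp only [one_smul, one_pow, one_mul] at this
    change φ (x + w) = φ x + fderiv ℝ φ x w + J x at this
    linarith
  have cJ : CC J := by
    have := (cφ.shift w).add ((cφ.const_mul (-1)).add (cD.const_mul (-1)))
    rwa [show J = _ from funext eJ]
  have e1 : (fun x => fderiv ℝ φ x w) = fun x => φ (x + w) + (-1 * φ x + -1 * J x) := by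
    funext x; rw [eJ]; ring
  rw [e1]
  have a1 := lp_add hp (cφ.shift w) ((cφ.const_mul (-1)).add (cJ.const_mul (-1)))
  have a2 := lp_add hp (cφ.const_mul (-1)) (cJ.const_mul (-1))
  rw [lp_smul hp, lp_smul hp] at a2
  rw [lp_shift] at a1
  simp at a1 a2
  simp
  linarith

lemma pd_eq (φ : E n → ℝ) (i : Fin n) : pd φ i = fun x => fderiv ℝ φ x (e i) := rfl

lemma pd2_eq {φ : E n → ℝ} (hφ : ContDiff ℝ (⊤ : ℕ∞) φ) (i j : Fin n) :
    pd2 φ i j = fun x => H φ x (e i) (e j) := by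
  funext x
  unfold pd2
  rw [pd_eq φ j]
  unfold pd H
  have := (((contDiff_fderiv' hφ).differentiable (by simp)) x).hasFDerivAt.clm_apply
    (hasFDerivAt_const (e j) x)
  rw [this.fderiv]
  simp [e]

lemma sqrt_sum_le {α : Type*} (s : Finset α) (f : α → ℝ) :
    Real.sqrt (∑ a ∈ s, f a ^ 2) ≤ ∑ a ∈ s, |f a| := by
  rw [Real.sqrt_le_left (Finset.sum_nonneg fun _ _ => abs_nonneg _)]
  have := Finset.sum_sq_le_sq_sum_of_nonneg (s := s) (f := fun a => |f a|) (fun _ _ => abs_nonneg _)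
  simpa using this

end CZ

theorem sobolev_norms_equivalent (n : ℕ) (hn : 1 ≤ n) (p : ℝ) (hp : 1 < p) :
    ∃ C : ℝ, 1 ≤ C ∧ ∀ φ : EuclideanSpace ℝ (Fin n) → ℝ,
      ContDiff ℝ (⊤ : ℕ∞) φ → HasCompactSupport φ →
      C⁻¹ * (lpNorm p φ + lpNorm p (lap φ)) ≤
          lpNorm p φ + lpNorm p (gradNorm φ) + lpNorm p (hessNorm φ) ∧
      lpNorm p φ + lpNorm p (gradNorm φ) + lpNorm p (hessNorm φ) ≤
          C * (lpNorm p φ + lpNorm p (lap φ)) := by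
  obtain ⟨K, hK, hKb⟩ := CZ.second_bound n hn p hp
  have hn0 : (1:ℝ) ≤ n := by exact_mod_cast hn
  set k : ℝ := 2 * K ^ (1 / p) with hk
  have hk0 : 0 ≤ k := by positivity
  refine ⟨1 + n + (n * (2 + k) + n * n * k), by
    have : 0 ≤ n * (2 + k) + n * n * k := by positivity
    linarith, fun φ hφ hs => ?_⟩
  have cφ : CZ.CC φ := ⟨hφ.continuous, hs⟩
  have cpd : ∀ i, CZ.CC (pd φ i) := fun i => CZ.D_cc hφ hs _
  have cpd2 : ∀ i j, CZ.CC (pd2 φ i j) := fun i j => by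
    rw [CZ.pd2_eq hφ]; exact CZ.H_cc hφ hs _ _
  have clap : CZ.CC (lap φ) := CZ.CC.sum Finset.univ fun i => cpd2 i i
  have chess : CZ.CC (hessNorm φ) := by
    have h1 := CZ.CC.sum Finset.univ fun i => CZ.CC.sum Finset.univ fun j => ((cpd2 i j).comp (g := fun t => t ^ 2) (by fun_prop) (by simp))
    exact h1.comp (g := Real.sqrt) Real.continuous_sqrt Real.sqrt_zero
  have n0 := CZ.lp_nonneg p φ
  have nl := CZ.lp_nonneg p (lap φ)
  have ng := CZ.lp_nonneg p (gradNorm φ)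
  have nh := CZ.lp_nonneg p (hessNorm φ)
  set X := lpNorm p φ + lpNorm p (lap φ) with hX
  have hX0 : 0 ≤ X := add_nonneg n0 nl
  have b2 : ∀ i j, lpNorm p (pd2 φ i j) ≤ k * X := by
    intro i j
    have h1 := hKb φ hφ hs i j
    have h2 : lpNorm p (pd2 φ i j) ≤ K ^ (1 / p) * lpNorm p (fun x => φ x + (-(2 / n)) * lap φ x) := by
      unfold _root_.lpNorm
      rw [← Real.mul_rpow hK.le (integral_nonneg fun x => by positivity)]
      refine Real.rpow_le_rpow (integral_nonneg fun x => by positivity) ?_ (by positivity)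
      rw [CZ.pd2_eq hφ]
      refine h1.trans (le_of_eq ?_)
      congr 2
      funext x
      simp only [lap, CZ.pd2_eq hφ]
      congr 2
      ring
    have h3 := CZ.lp_add hp cφ (clap.const_mul (-(2 / (n:ℝ))))
    rw [CZ.lp_smul hp] at h3
    have h4 : |(-(2 / (n:ℝ)))| ≤ 2 := by
      rw [abs_neg, abs_of_nonneg (by positivity)]
      exact div_le_self (by norm_num) hn0
    have h5 := mul_le_mul_of_nonneg_right h4 nl
    have h6 : lpNorm p (fun x => φ x + (-(2 / n)) * lap φ x) ≤ 2 * X := by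
      rw [hX]; linarith
    calc _ ≤ _ := h2
      _ ≤ K ^ (1 / p) * (2 * X) := by gcongr
      _ = k * X := by rw [hk]; ring
  have b1 : ∀ i, lpNorm p (pd φ i) ≤ (2 + k) * X := by
    intro i
    have h1 := CZ.grad_lp hp hφ hs (CZ.e i)
    have h2 := b2 i i
    rw [CZ.pd2_eq hφ] at h2
    rw [CZ.pd_eq]
    have : lpNorm p φ ≤ X := by rw [hX]; linarith
    linarith
  have bg : lpNorm p (gradNorm φ) ≤ n * ((2 + k) * X) := by
    have h1 : lpNorm p (gradNorm φ) ≤ lpNorm p (fun x => ∑ i, |pd φ i x|) := by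
      refine CZ.lp_mono hp (CZ.CC.sum _ fun i => (cpd i).comp continuous_abs abs_zero) fun x => ?_
      rw [abs_of_nonneg (a := gradNorm φ x) (Real.sqrt_nonneg _)]
      exact (CZ.sqrt_sum_le _ _).trans (le_abs_self _)
    have h2 := CZ.lp_sum hp Finset.univ fun i => (cpd i).comp continuous_abs abs_zero
    simp only [CZ.lp_abs] at h2
    have h3 := Finset.sum_le_sum (s := Finset.univ) fun i _ => b1 i
    simp only [Finset.sum_const, Finset.card_univ, Fintype.card_fin, nsmul_eq_mul] at h3
    linarith
  have bh : lpNorm p (hessNorm φ) ≤ n * n * (k * X) := by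
    have h1 : lpNorm p (hessNorm φ) ≤ lpNorm p (fun x => ∑ a : Fin n × Fin n, |pd2 φ a.1 a.2 x|) := by
      refine CZ.lp_mono hp (CZ.CC.sum _ fun a => (cpd2 a.1 a.2).comp continuous_abs abs_zero) fun x => ?_
      rw [abs_of_nonneg (a := hessNorm φ x) (Real.sqrt_nonneg _)]
      unfold hessNorm
      rw [← Fintype.sum_prod_type' (f := fun i j => pd2 φ i j x ^ 2)]
      exact (CZ.sqrt_sum_le _ (fun a : Fin n × Fin n => pd2 φ a.1 a.2 x)).trans (le_abs_self _)
    have h2 := CZ.lp_sum hp Finset.univ fun a : Fin n × Fin n => (cpd2 a.1 a.2).comp continuous_abs abs_zero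
    simp only [CZ.lp_abs] at h2
    have h3 := Finset.sum_le_sum (s := Finset.univ) fun (a : Fin n × Fin n) _ => b2 a.1 a.2
    simp only [Finset.sum_const, Finset.card_univ, Fintype.card_prod, Fintype.card_fin, nsmul_eq_mul, Nat.cast_mul] at h3
    linarith
  have bl : lpNorm p (lap φ) ≤ n * lpNorm p (hessNorm φ) := by
    have h1 : lpNorm p (lap φ) ≤ lpNorm p (fun x => n * hessNorm φ x) := by
      refine CZ.lp_mono hp (chess.const_mul n) fun x => ?_
      rw [abs_of_nonneg (a := n * hessNorm φ x) (mul_nonneg (by linarith) (Real.sqrt_nonneg _))]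
      unfold lap
      refine (Finset.abs_sum_le_sum_abs _ _).trans ?_
      have : ∀ i ∈ Finset.univ, |pd2 φ i i x| ≤ hessNorm φ x := by
        intro i _
        refine Real.abs_le_sqrt ?_
        refine le_trans ?_ (Finset.single_le_sum (f := fun i => ∑ j, pd2 φ i j x ^ 2)
          (fun i _ => Finset.sum_nonneg fun j _ => sq_nonneg _) (Finset.mem_univ i))
        exact Finset.single_le_sum (f := fun j => pd2 φ i j x ^ 2)
          (fun j _ => sq_nonneg _) (Finset.mem_univ i)
      refine (Finset.sum_le_sum this).trans (le_of_eq (by simp))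
    rw [CZ.lp_smul hp, abs_of_nonneg (by linarith)] at h1
    exact h1
  set A := lpNorm p φ
  set B := lpNorm p (gradNorm φ)
  set D := lpNorm p (hessNorm φ)
  have hpos : 0 ≤ n * (2 + k) + n * n * k := by positivity
  constructor
  · rw [inv_mul_le_iff₀ (by linarith)]
    have t1 : 0 ≤ (n * (2 + k) + n * n * k) * (A + B + D) := by positivity
    have t2 : 0 ≤ (n:ℝ) * (A + B) := by positivity
    have : X ≤ A + n * D := by rw [hX]; linarith
    nlinarith
  · have t1 : 0 ≤ (n:ℝ) * X := by positivity
    have : A ≤ X := by rw [hX]; linarith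
    nlinarith
end

section
/- Let u : ℝⁿ → ℝ be a smooth solution of the Poisson equation Δu = f on ℝⁿ. If u ∈ L²(ℝⁿ) and f ∈ L²(ℝⁿ), then |Hess u| ∈ L²(ℝⁿ) and ‖Hess u‖_{L²} ≤ ‖f‖_{L²}. -/
open MeasureTheory

open Filter Topology

section Aux
variable {n : ℕ}

lemma aux_pd_smooth {u : EuclideanSpace ℝ (Fin n) → ℝ} (hu : ContDiff ℝ (⊤ : ℕ∞) u) (i : Fin n) :
    ContDiff ℝ (⊤ : ℕ∞) (pd u i) := by
  have h : ContDiff ℝ (⊤ : ℕ∞) (fderiv ℝ u) := hu.fderiv_right (by simp)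
  exact h.clm_apply contDiff_const

lemma aux_diff {u : EuclideanSpace ℝ (Fin n) → ℝ} (hu : ContDiff ℝ (⊤ : ℕ∞) u) :
    Differentiable ℝ u := hu.differentiable (by simp)

lemma aux_pd_supp {u : EuclideanSpace ℝ (Fin n) → ℝ} (hu : HasCompactSupport u) (i : Fin n) :
    HasCompactSupport (pd u i) := hu.fderiv_apply (𝕜 := ℝ) _

lemma aux_pd_mul {u v : EuclideanSpace ℝ (Fin n) → ℝ} (hu : ContDiff ℝ (⊤ : ℕ∞) u)
    (hv : ContDiff ℝ (⊤ : ℕ∞) v) (i : Fin n) :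
    pd (fun x => u x * v x) i = fun x => u x * pd v i x + pd u i x * v x := by
  funext x
  simp only [pd]
  rw [fderiv_fun_mul (aux_diff hu x) (aux_diff hv x)]
  simp [mul_comm]

lemma aux_pd_add {u v : EuclideanSpace ℝ (Fin n) → ℝ} (hu : ContDiff ℝ (⊤ : ℕ∞) u)
    (hv : ContDiff ℝ (⊤ : ℕ∞) v) (i : Fin n) :
    pd (fun x => u x + v x) i = fun x => pd u i x + pd v i x := by
  funext x
  simp only [pd]
  rw [fderiv_fun_add (aux_diff hu x) (aux_diff hv x)]
  simp

lemma aux_pd_symm {u : EuclideanSpace ℝ (Fin n) → ℝ} (hu : ContDiff ℝ (⊤ : ℕ∞) u) (i j : Fin n) :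
    pd (pd u j) i = pd (pd u i) j := by
  funext x
  have hs : IsSymmSndFDerivAt ℝ u x :=
    hu.contDiffAt.isSymmSndFDerivAt (by
      rw [minSmoothness_of_isRCLikeNormedField]
      exact WithTop.coe_le_coe.2 (le_top : (2 : ℕ∞) ≤ ⊤))
  have h : ContDiff ℝ (⊤ : ℕ∞) (fderiv ℝ u) := hu.fderiv_right (by simp)
  have hd : DifferentiableAt ℝ (fderiv ℝ u) x := h.differentiable (by simp) x
  have key : ∀ i j : Fin n, pd (pd u j) i x
      = fderiv ℝ (fderiv ℝ u) x (EuclideanSpace.single i 1) (EuclideanSpace.single j 1) := by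
    intro i j
    unfold pd
    rw [fderiv_clm_apply hd (differentiableAt_const _)]
    simp
  rw [key, key]
  exact hs _ _

lemma aux_int {g : EuclideanSpace ℝ (Fin n) → ℝ} (hg : ContDiff ℝ (⊤ : ℕ∞) g)
    (hs : HasCompactSupport g) : Integrable g :=
  hg.continuous.integrable_of_hasCompactSupport hs

lemma aux_ibp {g : EuclideanSpace ℝ (Fin n) → ℝ} (hg : ContDiff ℝ (⊤ : ℕ∞) g)
    (hs : HasCompactSupport g) (i : Fin n) : ∫ x, pd g i x = 0 := by
  have h1 := aux_int (aux_pd_smooth hg i) (aux_pd_supp hs i)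
  have := integral_mul_fderiv_eq_neg_fderiv_mul_of_integrable (μ := volume)
    (f := fun _ : EuclideanSpace ℝ (Fin n) => (1:ℝ)) (g := g)
    (v := EuclideanSpace.single i 1) (by simp) (by simpa [pd] using! h1)
    (by simpa using aux_int hg hs) (fun x _ => differentiableAt_const _) (fun x _ => aux_diff hg x)
  simpa [pd] using this

/-- The `L²` identity for compactly supported functions. -/
lemma aux_hess_cs {v : EuclideanSpace ℝ (Fin n) → ℝ} (hv : ContDiff ℝ (⊤ : ℕ∞) v)
    (hs : HasCompactSupport v) :
    ∫ x, ∑ i, ∑ j, pd2 v i j x ^ 2 = ∫ x, lap v x ^ 2 := by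
  have hS : ∀ i j, ContDiff ℝ (⊤ : ℕ∞) (pd2 v i j) :=
    fun i j => aux_pd_smooth (aux_pd_smooth hv j) i
  have hC : ∀ i j, HasCompactSupport (pd2 v i j) :=
    fun i j => aux_pd_supp (aux_pd_supp hs j) i
  have e : ∀ i j, ∫ x, pd2 v i j x ^ 2 = ∫ x, pd2 v i i x * pd2 v j j x := by
    intro i j
    have hj := aux_pd_smooth hv j
    have a := aux_ibp (hj.mul (hS i j)) ((hC i j).mul_left) i
    have b := aux_ibp (hj.mul (hS i i)) ((hC i i).mul_left) j
    rw [aux_pd_mul hj (hS i j)] at a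
    rw [aux_pd_mul hj (hS i i)] at b
    have e3 : pd (pd2 v i j) i = pd (pd2 v i i) j := by
      change pd (pd (pd v j) i) i = pd (pd (pd v i) i) j
      rw [aux_pd_symm hv i j, aux_pd_symm (aux_pd_smooth hv i) i j]
    have ia : Integrable (fun x => pd v j x * pd (pd2 v i i) j x) :=
      aux_int (hj.mul (aux_pd_smooth (hS i i) j)) ((aux_pd_supp (hC i i) j).mul_left)
    have ib : Integrable (fun x => pd (pd v j) i x * pd2 v i j x) :=
      aux_int ((aux_pd_smooth hj i).mul (hS i j)) ((hC i j).mul_left)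
    have ic : Integrable (fun x => pd (pd v j) j x * pd2 v i i x) :=
      aux_int ((aux_pd_smooth hj j).mul (hS i i)) ((hC i i).mul_left)
    rw [e3, integral_add ia ib] at a
    rw [integral_add ia ic] at b
    have : ∫ x, pd (pd v j) i x * pd2 v i j x = ∫ x, pd (pd v j) j x * pd2 v i i x := by linarith
    calc _ = ∫ x, pd (pd v j) i x * pd2 v i j x := by
          congr 1; funext x; simp only [pd2]; ring
      _ = _ := by rw [this]; congr 1; funext x; simp only [pd2]; ring
  have i1 : ∀ i j, Integrable (fun x => pd2 v i j x ^ 2) := fun i j => by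
    simpa [pow_two] using aux_int ((hS i j).mul (hS i j)) ((hC i j).mul_left)
  have i2 : ∀ i j, Integrable (fun x => pd2 v i i x * pd2 v j j x) := fun i j =>
    aux_int ((hS i i).mul (hS j j)) ((hC j j).mul_left)
  have r : ∀ x, lap v x ^ 2 = ∑ i, ∑ j, pd2 v i i x * pd2 v j j x := by
    intro x; rw [lap, pow_two, Finset.sum_mul_sum]
  simp_rw [r]
  rw [integral_finsetSum _ (fun i _ => integrable_finsetSum _ (fun j _ => i1 i j)),
    integral_finsetSum _ (fun i _ => integrable_finsetSum _ (fun j _ => i2 i j))]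
  refine Finset.sum_congr rfl fun i _ => ?_
  rw [integral_finsetSum _ (fun j _ => i1 i j), integral_finsetSum _ (fun j _ => i2 i j)]
  exact Finset.sum_congr rfl fun j _ => e i j

/-- Fatou, in the form we need. -/
lemma aux_fatou {g : EuclideanSpace ℝ (Fin n) → ℝ} {G : ℕ → EuclideanSpace ℝ (Fin n) → ℝ}
    {a : ℕ → ℝ} {A : ℝ}
    (hg : Continuous g) (hg0 : ∀ x, 0 ≤ g x) (hG0 : ∀ k x, 0 ≤ G k x)
    (hGi : ∀ k, Integrable (G k)) (hGc : ∀ k, Continuous (G k))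
    (hlim : ∀ x, ∀ᶠ k in atTop, G k x = g x) (hle : ∀ k, ∫ x, G k x ≤ a k)
    (ha : Tendsto a atTop (𝓝 A)) : Integrable g ∧ ∫ x, g x ≤ A := by
  have hA : 0 ≤ A := ge_of_tendsto' ha fun k => (integral_nonneg (hG0 k)).trans (hle k)
  have key : ∫⁻ x, ENNReal.ofReal (g x) ≤ ENNReal.ofReal A := by
    calc ∫⁻ x, ENNReal.ofReal (g x)
        = ∫⁻ x, liminf (fun k => ENNReal.ofReal (G k x)) atTop := by
          congr 1; funext x
          refine (Tendsto.liminf_eq ?_).symm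
          refine tendsto_const_nhds.congr' ?_
          filter_upwards [hlim x] with k hk
          rw [hk]
      _ ≤ liminf (fun k => ∫⁻ x, ENNReal.ofReal (G k x)) atTop :=
          lintegral_liminf_le fun k => (hGc k).measurable.ennreal_ofReal
      _ ≤ liminf (fun k => ENNReal.ofReal (a k)) atTop := by
          refine liminf_le_liminf (Eventually.of_forall fun k => ?_)
          rw [← ofReal_integral_eq_lintegral_ofReal (hGi k) (Eventually.of_forall (hG0 k))]
          exact ENNReal.ofReal_le_ofReal (hle k)
      _ = ENNReal.ofReal A := ((ENNReal.continuous_ofReal.tendsto A).comp ha).liminf_eq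
  have hi : Integrable g := by
    refine ⟨hg.aestronglyMeasurable, ?_⟩
    rw [hasFiniteIntegral_iff_ofReal (Eventually.of_forall hg0)]
    exact key.trans_lt ENNReal.ofReal_lt_top
  refine ⟨hi, ?_⟩
  rw [← ofReal_integral_eq_lintegral_ofReal hi (Eventually.of_forall hg0)] at key
  exact (ENNReal.ofReal_le_ofReal_iff hA).1 key

lemma aux_pd_scale (g : EuclideanSpace ℝ (Fin n) → ℝ) (c : ℝ) (i : Fin n) :
    pd (fun x => g (c • x)) i = fun x => c * pd g i (c • x) := by
  funext x
  simp only [pd]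
  rw [fderiv_comp_smul]
  simp

lemma aux_pd_cmul {g : EuclideanSpace ℝ (Fin n) → ℝ} (hg : ContDiff ℝ (⊤ : ℕ∞) g) (c : ℝ)
    (i : Fin n) : pd (fun x => c * g x) i = fun x => c * pd g i x := by
  funext x
  simp only [pd]
  rw [fderiv_const_mul (aux_diff hg x)]
  simp

/-- Cutoff functions. -/
lemma aux_cutoff (n : ℕ) : ∃ (φ : ℕ → EuclideanSpace ℝ (Fin n) → ℝ) (C : ℝ),
    0 ≤ C ∧ (∀ k, ContDiff ℝ (⊤ : ℕ∞) (φ k)) ∧ (∀ k, HasCompactSupport (φ k)) ∧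
    (∀ k x, |φ k x| ≤ 1) ∧ (∀ k i x, |pd (φ k) i x| ≤ C) ∧ (∀ k i x, |pd2 (φ k) i i x| ≤ C) ∧
    (∀ x, ∀ᶠ k in atTop, ∀ᶠ y in 𝓝 x, φ k y = 1) := by
  let ψ : ContDiffBump (0 : EuclideanSpace ℝ (Fin n)) := ⟨1, 2, by norm_num, by norm_num⟩
  have hψ : ContDiff ℝ (⊤ : ℕ∞) (ψ : EuclideanSpace ℝ (Fin n) → ℝ) := ψ.contDiff
  have hs : HasCompactSupport (ψ : EuclideanSpace ℝ (Fin n) → ℝ) := ψ.hasCompactSupport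
  have b1 : ∀ i, ∃ C, ∀ x, ‖pd ψ i x‖ ≤ C := fun i =>
    (aux_pd_supp hs i).exists_bound_of_continuous (aux_pd_smooth hψ i).continuous
  have b2 : ∀ i, ∃ C, ∀ x, ‖pd2 ψ i i x‖ ≤ C := fun i =>
    (aux_pd_supp (aux_pd_supp hs i) i).exists_bound_of_continuous
      (aux_pd_smooth (aux_pd_smooth hψ i) i).continuous
  choose C1 hC1 using b1
  choose C2 hC2 using b2
  have p1 : ∀ i, 0 ≤ C1 i := fun i => (norm_nonneg _).trans (hC1 i 0)
  have p2 : ∀ i, 0 ≤ C2 i := fun i => (norm_nonneg _).trans (hC2 i 0)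
  have q1 : ∀ i, C1 i ≤ ∑ i, (C1 i + C2 i) := fun i =>
    (le_add_of_nonneg_right (p2 i)).trans
      (Finset.single_le_sum (f := fun i => C1 i + C2 i) (fun j _ => add_nonneg (p1 j) (p2 j))
        (Finset.mem_univ i))
  have q2 : ∀ i, C2 i ≤ ∑ i, (C1 i + C2 i) := fun i =>
    (le_add_of_nonneg_left (p1 i)).trans
      (Finset.single_le_sum (f := fun i => C1 i + C2 i) (fun j _ => add_nonneg (p1 j) (p2 j))
        (Finset.mem_univ i))
  let c : ℕ → ℝ := fun k => 1 / ((k : ℝ) + 1)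
  have c0 : ∀ k, 0 < c k := fun k => by positivity
  have c1 : ∀ k, c k ≤ 1 := fun k => by
    simp only [c]; rw [div_le_one (by positivity)]; linarith [Nat.cast_nonneg (α := ℝ) k]
  have cl : Tendsto c atTop (𝓝 0) := tendsto_one_div_add_atTop_nhds_zero_nat
  have hlin : ∀ k, ContDiff ℝ (⊤ : ℕ∞) (fun x : EuclideanSpace ℝ (Fin n) => c k • x) :=
    fun k => contDiff_id.const_smul (c k)
  refine ⟨fun k x => ψ (c k • x), ∑ i, (C1 i + C2 i),
    Finset.sum_nonneg fun i _ => add_nonneg (p1 i) (p2 i), fun k => hψ.comp (hlin k), fun k => ?_,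
    fun k x => ?_, fun k i x => ?_, fun k i x => ?_, fun x => ?_⟩
  · exact hs.comp_homeomorph (Homeomorph.smulOfNeZero (c k) (c0 k).ne')
  · rw [abs_of_nonneg ψ.nonneg]; exact ψ.le_one
  · rw [aux_pd_scale]
    simp only [abs_mul, abs_of_pos (c0 k)]
    have := hC1 i (c k • x)
    rw [Real.norm_eq_abs] at this
    nlinarith [c0 k, c1 k, q1 i, abs_nonneg (pd ψ i (c k • x))]
  · simp only [pd2]
    rw [aux_pd_scale, aux_pd_cmul (g := fun x => pd ψ i (c k • x)) ((aux_pd_smooth hψ i).comp (hlin k)), aux_pd_scale]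
    simp only [abs_mul, abs_of_pos (c0 k)]
    have := hC2 i (c k • x)
    rw [Real.norm_eq_abs] at this
    simp only [pd2] at this
    have h0 := abs_nonneg (pd (pd ψ i) i (c k • x))
    have h1 : c k * |pd (pd ψ i) i (c k • x)| ≤ |pd (pd ψ i) i (c k • x)| :=
      mul_le_of_le_one_left h0 (c1 k)
    have h2 := mul_le_of_le_one_left (mul_nonneg (c0 k).le h0) (c1 k)
    linarith [q2 i]
  · have ht : Tendsto (fun k => c k • x) atTop (𝓝 0) := by
      simpa using cl.smul_const x
    filter_upwards [ht (Metric.ball_mem_nhds 0 one_pos)] with k hk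
    have hcont : ContinuousAt (fun y : EuclideanSpace ℝ (Fin n) => c k • y) x :=
      (hlin k).continuous.continuousAt
    filter_upwards [hcont (Metric.isOpen_ball.mem_nhds hk)] with y hy
    exact ψ.one_of_mem_closedBall (Metric.ball_subset_closedBall hy)

lemma aux_pd_congr {u v : EuclideanSpace ℝ (Fin n) → ℝ} {x : EuclideanSpace ℝ (Fin n)}
    (h : u =ᶠ[𝓝 x] v) (i : Fin n) : pd u i =ᶠ[𝓝 x] pd v i := by
  filter_upwards [h.fderiv (𝕜 := ℝ)] with y hy
  simp only [pd, hy]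

end Aux

theorem L2_hessian_estimate_poisson (n : ℕ) (u f : EuclideanSpace ℝ (Fin n) → ℝ)
    (hu : ContDiff ℝ (⊤ : ℕ∞) u) (hPoisson : ∀ x, lap u x = f x)
    (huL2 : Integrable (fun x => u x ^ 2)) (hfL2 : Integrable (fun x => f x ^ 2)) :
    Integrable (fun x => hessNorm u x ^ 2) ∧ lpNorm 2 (hessNorm u) ≤ lpNorm 2 f := by
  obtain ⟨φ, C, hC, hφ, hφs, hφ1, hφd, hφdd, hφl⟩ := aux_cutoff n
  have hui : ∀ i, ContDiff ℝ (⊤ : ℕ∞) (pd u i) := aux_pd_smooth hu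
  have huij : ∀ i j, ContDiff ℝ (⊤ : ℕ∞) (pd2 u i j) := fun i j => aux_pd_smooth (hui j) i
  have hv : ∀ k, ContDiff ℝ (⊤ : ℕ∞) (fun x => φ k x * u x) := fun k => (hφ k).mul hu
  have hvs : ∀ k, HasCompactSupport (fun x => φ k x * u x) := fun k => (hφs k).mul_right
  have hvl : ∀ x, ∀ᶠ k in atTop, (fun y => φ k y * u y) =ᶠ[𝓝 x] u := by
    intro x
    filter_upwards [hφl x] with k hk
    filter_upwards [hk] with y hy
    simp [hy]
  have hfs : ContDiff ℝ (⊤ : ℕ∞) f := by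
    have : f = fun x => ∑ i, pd2 u i i x := by funext x; rw [← hPoisson x]; rfl
    rw [this]
    exact ContDiff.sum fun i _ => huij i i
  -- gradient bound
  have hgrad : Integrable (fun x => ∑ i, pd u i x ^ 2) := by
    refine (aux_fatou (G := fun k x => ∑ i, pd (fun y => φ k y * u y) i x ^ 2)
      (a := fun _ => ∫ x, ((n * C ^ 2 + 1) * u x ^ 2 + f x ^ 2))
      (continuous_finsetSum _ fun i _ => (hui i).continuous.pow 2)
      (fun x => Finset.sum_nonneg fun i _ => sq_nonneg _)
      (fun k x => Finset.sum_nonneg fun i _ => sq_nonneg _) (fun k => ?_)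
      (fun k => continuous_finsetSum _ fun i _ => (aux_pd_smooth (hv k) i).continuous.pow 2)
      (fun x => ?_) (fun k => ?_) tendsto_const_nhds).1
    · refine integrable_finsetSum _ fun i _ => ?_
      simpa [pow_two] using aux_int ((aux_pd_smooth (hv k) i).mul (aux_pd_smooth (hv k) i))
        ((aux_pd_supp (hvs k) i).mul_left)
    · filter_upwards [hvl x] with k hk
      refine Finset.sum_congr rfl fun i _ => ?_
      have := (aux_pd_congr hk i).eq_of_nhds
      simp only [this, Pi.pow_apply]
    · have hw : ∀ i, ContDiff ℝ (⊤ : ℕ∞) (fun x => φ k x * (φ k x * (u x * pd u i x))) :=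
        fun i => (hφ k).mul ((hφ k).mul (hu.mul (hui i)))
      have hws : ∀ i, HasCompactSupport (fun x => φ k x * (φ k x * (u x * pd u i x))) :=
        fun i => (hφs k).mul_right
      have hz : ∫ x, ∑ i, pd (fun x => φ k x * (φ k x * (u x * pd u i x))) i x = 0 := by
        rw [integral_finsetSum _ fun i _ =>
          aux_int (aux_pd_smooth (hw i) i) (aux_pd_supp (hws i) i)]
        exact Finset.sum_eq_zero fun i _ => aux_ibp (hw i) (hws i) i
      have hzi : Integrable
          (fun x => ∑ i, pd (fun x => φ k x * (φ k x * (u x * pd u i x))) i x) :=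
        integrable_finsetSum _ fun i _ =>
          aux_int (aux_pd_smooth (hw i) i) (aux_pd_supp (hws i) i)
      have hR : Integrable (fun x => (n * C ^ 2 + 1) * u x ^ 2 + f x ^ 2) :=
        (huL2.const_mul _).add hfL2
      rw [← add_zero (∫ x, ((n * C ^ 2 + 1) * u x ^ 2 + f x ^ 2)), ← hz, ← integral_add hR hzi]
      refine integral_mono_of_nonneg
        (Eventually.of_forall fun x => Finset.sum_nonneg fun i _ => sq_nonneg _) (hR.add hzi)
        (Eventually.of_forall fun x => ?_)
      have e1 : ∀ i, pd (fun y => φ k y * u y) i x ^ 2 =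
          pd (fun x => φ k x * (φ k x * (u x * pd u i x))) i x
          + u x ^ 2 * pd (φ k) i x ^ 2 - φ k x ^ 2 * u x * pd2 u i i x := by
        intro i
        rw [aux_pd_mul (hφ k) hu, aux_pd_mul (hφ k) ((hφ k).mul (hu.mul (hui i))),
          aux_pd_mul (hφ k) (hu.mul (hui i)), aux_pd_mul hu (hui i)]
        simp only [pd2]
        ring
      simp only [e1, Finset.sum_sub_distrib, Finset.sum_add_distrib, ← Finset.mul_sum]
      have e2 : ∑ i, pd2 u i i x = f x := hPoisson x
      rw [e2]
      have e3 : ∑ i, pd (φ k) i x ^ 2 ≤ n * C ^ 2 := by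
        calc _ ≤ ∑ i : Fin n, C ^ 2 := Finset.sum_le_sum fun i _ => by
              rw [← sq_abs]; exact pow_le_pow_left₀ (abs_nonneg _) (hφd k i x) 2
          _ = _ := by simp
      have e4 : -(φ k x ^ 2 * u x * f x) ≤ u x ^ 2 + f x ^ 2 := by
        have h0 : φ k x ^ 2 ≤ 1 := by
          rw [← sq_abs]; exact pow_le_one₀ (abs_nonneg _) (hφ1 k x)
        have h1 : -(u x * f x) ≤ u x ^ 2 + f x ^ 2 := by nlinarith [sq_nonneg (u x + f x), sq_nonneg (u x), sq_nonneg (f x)]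
        have h2 : 0 ≤ u x ^ 2 + f x ^ 2 := by positivity
        nlinarith [mul_le_mul_of_nonneg_left h1 (sq_nonneg (φ k x)), mul_le_of_le_one_left h2 h0]
      have e5 := mul_le_mul_of_nonneg_left e3 (sq_nonneg (u x))
      linarith
  have hgi : ∀ i, MemLp (pd u i) 2 := by
    intro i
    rw [memLp_two_iff_integrable_sq (hui i).continuous.aestronglyMeasurable]
    refine hgrad.mono' ((hui i).continuous.pow 2).aestronglyMeasurable
      (Eventually.of_forall fun x => ?_)
    rw [Real.norm_eq_abs, abs_of_nonneg (sq_nonneg _)]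
    exact Finset.single_le_sum (f := fun i => pd u i x ^ 2) (fun j _ => sq_nonneg _)
      (Finset.mem_univ i)
  have huM : MemLp u 2 :=
    (memLp_two_iff_integrable_sq hu.continuous.aestronglyMeasurable).2 huL2
  have hfM : MemLp f 2 :=
    (memLp_two_iff_integrable_sq hfs.continuous.aestronglyMeasurable).2 hfL2
  -- the dominating function
  have hB : Integrable
      (fun x => (|f x| + ∑ i : Fin n, (2 * C * |pd u i x| + C * |u x|)) ^ 2) := by
    refine MemLp.integrable_sq (hfM.abs.add (memLp_finsetSum _ fun i _ => ?_))
    exact ((hgi i).abs.const_mul _).add (huM.abs.const_mul _)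
  have hlapc : ∀ k, Continuous (fun x => lap (fun y => φ k y * u y) x) := fun k =>
    continuous_finsetSum _ fun i _ =>
      (aux_pd_smooth (aux_pd_smooth (hv k) i) i).continuous
  have hlim : Tendsto (fun k => ∫ x, lap (fun y => φ k y * u y) x ^ 2) atTop
      (𝓝 (∫ x, f x ^ 2)) := by
    refine tendsto_integral_of_dominated_convergence _
      (fun k => ((hlapc k).pow 2).aestronglyMeasurable) hB
      (fun k => Eventually.of_forall fun x => ?_) (Eventually.of_forall fun x => ?_)
    · rw [Real.norm_eq_abs, abs_of_nonneg (sq_nonneg _), ← sq_abs]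
      refine pow_le_pow_left₀ (abs_nonneg _) ?_ 2
      have e1 : lap (fun y => φ k y * u y) x
          = φ k x * f x + ∑ i, (2 * pd (φ k) i x * pd u i x + pd2 (φ k) i i x * u x) := by
        rw [← hPoisson x]
        simp only [lap, Finset.mul_sum, ← Finset.sum_add_distrib]
        refine Finset.sum_congr rfl fun i _ => ?_
        simp only [pd2]
        rw [aux_pd_mul (hφ k) hu, aux_pd_add ((hφ k).mul (hui i)) ((aux_pd_smooth (hφ k) i).mul hu),
          aux_pd_mul (hφ k) (hui i), aux_pd_mul (aux_pd_smooth (hφ k) i) hu]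
        ring
      rw [e1]
      refine (abs_add_le _ _).trans (add_le_add ?_ ?_)
      · rw [abs_mul]; exact mul_le_of_le_one_left (abs_nonneg _) (hφ1 k x)
      · refine (Finset.abs_sum_le_sum_abs _ _).trans (Finset.sum_le_sum fun i _ => ?_)
        refine (abs_add_le _ _).trans (add_le_add ?_ ?_)
        · rw [abs_mul, abs_mul, abs_two]
          have := hφd k i x
          gcongr
        · rw [abs_mul]
          have := hφdd k i x
          gcongr
    · refine tendsto_const_nhds.congr' ?_
      filter_upwards [hvl x] with k hk
      rw [← hPoisson x]
      congr 1
      exact Finset.sum_congr rfl fun i _ =>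
        (aux_pd_congr (aux_pd_congr hk i) i).eq_of_nhds.symm
  have main := aux_fatou (g := fun x => ∑ i, ∑ j, pd2 u i j x ^ 2)
      (G := fun k x => ∑ i, ∑ j, pd2 (fun y => φ k y * u y) i j x ^ 2)
      (continuous_finsetSum _ fun i _ => continuous_finsetSum _ fun j _ =>
        (huij i j).continuous.pow 2)
      (fun x => Finset.sum_nonneg fun i _ => Finset.sum_nonneg fun j _ => sq_nonneg _)
      (fun k x => Finset.sum_nonneg fun i _ => Finset.sum_nonneg fun j _ => sq_nonneg _)
      (fun k => integrable_finsetSum _ fun i _ => integrable_finsetSum _ fun j _ => by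
        have h1 := aux_pd_smooth (aux_pd_smooth (hv k) j) i
        simpa [pow_two, pd2] using aux_int (h1.mul h1)
          ((aux_pd_supp (aux_pd_supp (hvs k) j) i).mul_left))
      (fun k => continuous_finsetSum _ fun i _ => continuous_finsetSum _ fun j _ =>
        (aux_pd_smooth (aux_pd_smooth (hv k) j) i).continuous.pow 2)
      (fun x => by
        filter_upwards [hvl x] with k hk
        refine Finset.sum_congr rfl fun i _ => Finset.sum_congr rfl fun j _ => ?_
        simp only [pd2]
        rw [(aux_pd_congr (aux_pd_congr hk j) i).eq_of_nhds])
      (fun k => (aux_hess_cs (hv k) (hvs k)).le) hlim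
  have hh : ∀ x, hessNorm u x ^ 2 = ∑ i, ∑ j, pd2 u i j x ^ 2 := fun x =>
    Real.sq_sqrt (Finset.sum_nonneg fun i _ => Finset.sum_nonneg fun j _ => sq_nonneg _)
  refine ⟨by simpa only [hh] using main.1, ?_⟩
  simp only [_root_.lpNorm, Real.rpow_two, sq_abs, hh]
  refine Real.rpow_le_rpow (integral_nonneg fun x => ?_) main.2 (by norm_num)
  exact Finset.sum_nonneg fun i _ => Finset.sum_nonneg fun j _ => sq_nonneg _
end

section
/- For every λ > 0, the equation Δu = λu has no non-zero smooth L² solution on ℝⁿ: if u : ℝⁿ → ℝ is smooth, u ∈ L²(ℝⁿ), and ∑ᵢ ∂ᵢ²u(x) = λ u(x) for all x ∈ ℝⁿ with λ > 0, then u ≡ 0. -/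
open MeasureTheory

lemma pd_smooth {n : ℕ} {u : EuclideanSpace ℝ (Fin n) → ℝ} (hu : ContDiff ℝ (⊤ : ℕ∞) u)
    (i : Fin n) : ContDiff ℝ (⊤ : ℕ∞) (pd u i) := by
  unfold pd
  exact (hu.fderiv_right (m := (⊤ : ℕ∞)) (by norm_cast)).clm_apply contDiff_const

lemma pd_compact {n : ℕ} {u : EuclideanSpace ℝ (Fin n) → ℝ} (hu : HasCompactSupport u)
    (i : Fin n) : HasCompactSupport (pd u i) := by
  unfold pd
  exact hu.fderiv_apply ℝ _

lemma caccioppoli {n : ℕ} (lam : ℝ)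
    (u : EuclideanSpace ℝ (Fin n) → ℝ) (hu : ContDiff ℝ (⊤ : ℕ∞) u)
    (heq : ∀ x, lap u x = lam * u x)
    (f : EuclideanSpace ℝ (Fin n) → ℝ) (hf : ContDiff ℝ (⊤ : ℕ∞) f) (hc : HasCompactSupport f) :
    lam * ∫ x, f x ^ 2 * u x ^ 2 ≤ ∫ x, (∑ i, pd f i x ^ 2) * u x ^ 2 := by
  have cu := hu.continuous
  have cf := hf.continuous
  have cpu := fun i => (pd_smooth hu i).continuous
  have cpf := fun i => (pd_smooth hf i).continuous
  have cppu := fun i => (pd_smooth (pd_smooth hu i) i).continuous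
  have du : Differentiable ℝ u := hu.differentiable (by simp)
  have df : Differentiable ℝ f := hf.differentiable (by simp)
  have dpu := fun i => (pd_smooth hu i).differentiable (by simp)
  have I1 : ∀ i, Integrable (fun x => (f x * (f x * u x)) * pd (pd u i) i x) := fun i =>
    Continuous.integrable_of_hasCompactSupport (by fun_prop) (hc.mul_right.mul_right)
  have I2 : ∀ i, Integrable (fun x => (f x * (f x * u x)) * pd u i x) := fun i =>
    Continuous.integrable_of_hasCompactSupport (by fun_prop) (hc.mul_right.mul_right)
  have I4 : ∀ i, Integrable (fun x => pd f i x ^ 2 * u x ^ 2) := fun i => by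
    simp only [sq (pd f i _), mul_assoc]
    exact Continuous.integrable_of_hasCompactSupport (by fun_prop) (pd_compact hc i).mul_right
  have hd : ∀ i x, fderiv ℝ (fun x => f x * (f x * u x)) x (EuclideanSpace.single i 1)
      = f x * (f x * pd u i x + 2 * pd f i x * u x) := fun i x => by
    rw [fderiv_fun_mul (df x) ((df x).fun_mul (du x)), fderiv_fun_mul (df x) (du x)]
    simp [pd]
    ring
  have I3 : ∀ i, Integrable (fun x => f x * (f x * pd u i x + 2 * pd f i x * u x) * pd u i x) :=
    fun i => Continuous.integrable_of_hasCompactSupport (by fun_prop) (hc.mul_right.mul_right)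
  have key : ∀ i, ∫ x, (f x * (f x * u x)) * pd (pd u i) i x ≤ ∫ x, pd f i x ^ 2 * u x ^ 2 := by
    intro i
    have := integral_mul_fderiv_eq_neg_fderiv_mul_of_integrable (μ := volume)
      (f := fun x => f x * (f x * u x)) (g := pd u i) (v := EuclideanSpace.single i (1:ℝ))
      (by simpa only [hd] using I3 i) (I1 i) (I2 i) (fun x _ => (df.mul (df.mul du)) x) (fun x _ => dpu i x)
    change ∫ x, (f x * (f x * u x)) * pd (pd u i) i x = _ at this
    rw [this, ← integral_neg]
    simp only [hd]
    refine integral_mono (I3 i).neg (I4 i) fun x => ?_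
    simp only
    nlinarith [sq_nonneg (f x * pd u i x + pd f i x * u x)]
  calc lam * ∫ x, f x ^ 2 * u x ^ 2
      = ∑ i, ∫ x, (f x * (f x * u x)) * pd (pd u i) i x := by
        rw [← integral_finsetSum _ (fun i _ => I1 i), ← integral_const_mul]
        congr 1; ext x
        rw [← Finset.mul_sum]
        have h := heq x
        simp only [lap, pd2] at h
        rw [h]; ring
    _ ≤ ∑ i, ∫ x, pd f i x ^ 2 * u x ^ 2 := Finset.sum_le_sum fun i _ => key i
    _ = _ := by
        rw [← integral_finsetSum _ (fun i _ => I4 i)]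
        simp only [Finset.sum_mul]

theorem no_L2_eigenfunction_positive_eigenvalue (n : ℕ) (lam : ℝ) (hlam : 0 < lam)
    (u : EuclideanSpace ℝ (Fin n) → ℝ) (hu : ContDiff ℝ (⊤ : ℕ∞) u)
    (huL2 : Integrable (fun x => u x ^ 2))
    (heq : ∀ x, lap u x = lam * u x) :
    ∀ x, u x = 0 := by
  let χ : ContDiffBump (0 : EuclideanSpace ℝ (Fin n)) := ⟨1, 2, by norm_num, by norm_num⟩
  have hχ : ContDiff ℝ (⊤ : ℕ∞) (χ : EuclideanSpace ℝ (Fin n) → ℝ) := χ.contDiff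
  have hχc : HasCompactSupport (χ : EuclideanSpace ℝ (Fin n) → ℝ) := χ.hasCompactSupport
  have cu := hu.continuous
  -- bound on the gradient
  have hG : ∃ C, ∀ x, ‖∑ i, pd χ i x * pd χ i x‖ ≤ C := by
    have h1 : ∀ i, ∃ C, ∀ x, ‖pd χ i x‖ ≤ C := fun i =>
      (pd_compact hχc i).exists_bound_of_continuous (pd_smooth hχ i).continuous
    choose C hC using h1
    refine ⟨∑ i, C i * C i, fun x => (norm_sum_le _ _).trans (Finset.sum_le_sum fun i _ => ?_)⟩
    rw [norm_mul]
    exact mul_le_mul (hC i x) (hC i x) (norm_nonneg _) ((norm_nonneg _).trans (hC i x))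
  obtain ⟨C, hC⟩ := hG
  let c : ℕ → ℝ := fun k => 1 / ((k : ℝ) + 1)
  have hc0 : ∀ k, c k ≠ 0 := fun k => by positivity
  have hct : Filter.Tendsto c Filter.atTop (nhds 0) := tendsto_one_div_add_atTop_nhds_zero_nat
  have hbound : ∀ k, lam * ∫ x, χ (c k • x) ^ 2 * u x ^ 2 ≤ (c k) ^ 2 * (C * ∫ x, u x ^ 2) := by
    intro k
    have hs : ContDiff ℝ (⊤ : ℕ∞) (fun x => χ (c k • x)) :=
      hχ.comp (contDiff_const_smul (c k))
    have hsc : HasCompactSupport (fun x => χ (c k • x)) := hχc.comp_smul (hc0 k)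
    refine (caccioppoli lam u hu heq _ hs hsc).trans ?_
    have hpd : ∀ i x, pd (fun x => χ (c k • x)) i x = c k * pd χ i (c k • x) := by
      intro i x
      simp only [pd]
      rw [fderiv_comp_smul]
      simp
    rw [← mul_assoc, ← integral_const_mul]
    refine integral_mono_of_nonneg (Filter.Eventually.of_forall fun x => ?_)
      (huL2.const_mul _) (Filter.Eventually.of_forall fun x => ?_)
    · simp only [Pi.zero_apply]
      positivity
    · simp only [hpd, mul_pow, ← Finset.mul_sum]
      gcongr
      simp only [sq (pd _ _ _)]
      exact (le_abs_self _).trans (hC _)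
  have hlim1 : Filter.Tendsto (fun k => ∫ x, χ (c k • x) ^ 2 * u x ^ 2) Filter.atTop
      (nhds (∫ x, u x ^ 2)) := by
    refine tendsto_integral_of_dominated_convergence (fun x => u x ^ 2) (fun k => ?_) huL2
      (fun k => Filter.Eventually.of_forall fun x => ?_)
      (Filter.Eventually.of_forall fun x => ?_)
    · have := χ.continuous
      exact Continuous.aestronglyMeasurable (by fun_prop)
    · rw [norm_mul, Real.norm_of_nonneg (sq_nonneg (u x)), Real.norm_of_nonneg (sq_nonneg _)]
      exact mul_le_of_le_one_left (sq_nonneg _) (pow_le_one₀ χ.nonneg χ.le_one)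
    · have h1 : Filter.Tendsto (fun k => χ (c k • x)) Filter.atTop (nhds 1) := by
        have h2 : χ ((0:ℝ) • x) = 1 := by
          apply χ.one_of_mem_closedBall
          simp [χ]
        rw [← h2]
        exact (χ.continuous.tendsto _).comp (hct.smul_const x)
      simpa using (h1.pow 2).mul_const (u x ^ 2)
  have hle : lam * ∫ x, u x ^ 2 ≤ 0 := by
    have h2 : Filter.Tendsto (fun k => (c k) ^ 2 * (C * ∫ x, u x ^ 2)) Filter.atTop (nhds 0) := by
      simpa using (hct.pow 2).mul_const (C * ∫ x, u x ^ 2)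
    exact le_of_tendsto_of_tendsto' (hlim1.const_mul lam) h2 hbound
  have hz : ∫ x, u x ^ 2 = 0 :=
    le_antisymm (by nlinarith) (integral_nonneg fun x => sq_nonneg _)
  rw [integral_eq_zero_iff_of_nonneg (fun x => sq_nonneg _) huL2] at hz
  have h0 : (fun x => u x ^ 2) = fun _ => (0 : ℝ) :=
    (Continuous.ae_eq_iff_eq volume (cu.pow 2) continuous_const).1 hz
  intro x
  have h1 : u x ^ 2 = 0 := congrFun h0 x
  exact pow_eq_zero_iff (two_ne_zero) |>.1 h1
end
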